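/- arXiv:1201.5073 — 11 statements merged into one kernel-verified Lean document; each statement's English description precedes it below -/
import Mathlib

section
/- In a multi energy parity game, if player P₁ has a winning strategy (i.e., there exist an initial credit v₀ ∈ ℕ^k and a pure, possibly infinite-memory, strategy of P₁ such that every play consistent with it satisfies PosEnergy(v₀) ∩ Parity), then P₁ has a pure finite-memory winning strategy: there exist v₀' ∈ ℕ^k and a pure strategy of P₁ encoded by a deterministic Moore machine with finitely many memory states, all of whose consistent plays satisfy PosEnergy(v₀') ∩ Parity. -/
namespace Stmt0

/-- A play from `s0` in the game graph `E`. -/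
def IsPlayFrom {S : Type} (E : S → S → Prop) (s0 : S) (π : ℕ → S) : Prop :=
  π 0 = s0 ∧ ∀ i, E (π i) (π (i + 1))

/-- Energy level of the prefix of length `n` of a play, in dimension `j`. -/
def EL {S : Type} {k : ℕ} (w : S → S → Fin k → ℤ) (π : ℕ → S) (n : ℕ) (j : Fin k) : ℤ :=
  ∑ i ∈ Finset.range n, w (π i) (π (i + 1)) j

/-- Multi energy objective for initial credit `v0`. -/
def PosEnergy {S : Type} {k : ℕ} (w : S → S → Fin k → ℤ) (v0 : Fin k → ℕ) (π : ℕ → S) :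
    Prop :=
  ∀ n j, 0 ≤ (v0 j : ℤ) + EL w π n j

/-- `s` occurs infinitely often along `π`. -/
def InfOft {S : Type} (π : ℕ → S) (s : S) : Prop :=
  ∀ N, ∃ n, N ≤ n ∧ π n = s

/-- Parity objective: the minimal priority visited infinitely often is even. -/
def ParityWin {S : Type} (p : S → ℕ) (π : ℕ → S) : Prop :=
  Even (sInf (p '' {s | InfOft π s}))

/-- A pure strategy of player 1 (mapping history and current state to a successor)
is legal if it follows edges at states of player 1. -/
def IsStrat1 {S : Type} (isP1 : S → Prop) (E : S → S → Prop) (σ : List S → S → S) : Prop :=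
  ∀ h s, isP1 s → E s (σ h s)

/-- The history (strict prefix) of a play before time `n`. -/
def Hist {S : Type} (π : ℕ → S) (n : ℕ) : List S := (List.range n).map π

/-- A play is consistent with a strategy of player 1. -/
def Consistent1 {S : Type} (isP1 : S → Prop) (σ : List S → S → S) (π : ℕ → S) : Prop :=
  ∀ n, isP1 (π n) → π (n + 1) = σ (Hist π n) (π n)

/-- The strategy induced by a deterministic Moore machine `(M, m0, αu, αn)`. -/
def MooreStrat {S M : Type} (m0 : M) (αu : M → S → M) (αn : M → S → S) :
    List S → S → S :=
  fun h s => αn (h.foldl αu m0) s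

/-- The history before time `n`, most recent state first. -/
def revHist {S : Type} (π : ℕ → S) : ℕ → List S
  | 0 => []
  | n + 1 => π n :: revHist π n

lemma reverse_revHist {S : Type} (π : ℕ → S) (n : ℕ) : (revHist π n).reverse = Hist π n := by
  induction n with
  | zero => rfl
  | succ n ih => simp [revHist, ih, Hist, List.range_succ]

lemma length_revHist {S : Type} (π : ℕ → S) (n : ℕ) : (revHist π n).length = n := by
  induction n with
  | zero => rfl
  | succ n ih => simp [revHist, ih]

lemma revHist_split {S : Type} (π : ℕ → S) {i j : ℕ} (hij : i ≤ j) :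
    ∃ seg, revHist π j = seg ++ revHist π i ∧ ∀ y ∈ seg, ∃ t, i ≤ t ∧ y = π t := by
  induction j, hij using Nat.le_induction with
  | base => exact ⟨[], rfl, by simp⟩
  | succ j hij ih =>
    obtain ⟨seg, h, hy⟩ := ih
    refine ⟨π j :: seg, by simp [revHist, h], fun y hmem => ?_⟩
    rcases List.mem_cons.1 hmem with rfl | hmem
    · exact ⟨j, hij, rfl⟩
    · exact hy y hmem

/-- A property of lists that can always be maintained by consing one element holds along
an infinite branch. -/
lemma exists_branch {S : Type} (P : List S → Prop) (h0 : P [])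
    (hs : ∀ l, P l → ∃ s, P (s :: l)) : ∃ π : ℕ → S, ∀ n, P (revHist π n) := by
  choose f hf using hs
  let g : ℕ → {l // P l} := fun n =>
    Nat.rec ⟨[], h0⟩ (fun _ l => ⟨f l.1 l.2 :: l.1, hf l.1 l.2⟩) n
  let π : ℕ → S := fun n => f (g n).1 (g n).2
  have hg : ∀ n, (g n).1 = revHist π n := by
    intro n
    induction n with
    | zero => rfl
    | succ n ih =>
      change f (g n).1 (g n).2 :: (g n).1 = π n :: revHist π n
      rw [← ih]
  exact ⟨π, fun n => hg n ▸ (g n).2⟩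

/-- König's lemma for a set of lists closed under suffixes over a finite alphabet. -/
lemma exists_branch_of_infinite {S : Type} [Finite S] (T : List S → Prop)
    (hT : ∀ l l', T l' → l <:+ l' → T l) (hinf : {l | T l}.Infinite) :
    ∃ π : ℕ → S, ∀ n, T (revHist π n) := by
  obtain ⟨π, hπ⟩ := exists_branch (fun l => {l' | T l' ∧ l <:+ l'}.Infinite)
    (by simpa using hinf) (by
      intro l hl
      by_contra! hcon
      refine hl (((Set.finite_singleton l).union
        (Set.finite_iUnion fun s => hcon s)).subset ?_)
      rintro l' ⟨h1, c, rfl⟩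
      rcases List.eq_nil_or_concat c with rfl | ⟨c, s, rfl⟩
      · simp
      · right
        simp only [Set.mem_iUnion]
        exact ⟨s, h1, c, by simp⟩)
  refine ⟨π, fun n => ?_⟩
  obtain ⟨l', h1, h2⟩ := (hπ n).nonempty
  exact hT _ _ h1 h2

/-- Energy level of a path listed most recent state first. -/
def pathEnergy {S : Type} {k : ℕ} (w : S → S → Fin k → ℤ) : List S → Fin k → ℤ
  | [] => 0
  | [_] => 0
  | s :: t :: l => pathEnergy w (t :: l) + w t s

lemma pathEnergy_revHist {S : Type} {k : ℕ} (w : S → S → Fin k → ℤ) (π : ℕ → S) (n : ℕ)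
    (j : Fin k) : pathEnergy w (revHist π (n + 1)) j = EL w π n j := by
  induction n with
  | zero => simp [revHist, pathEnergy, EL]
  | succ n ih =>
    rw [EL, Finset.sum_range_succ, ← EL, ← ih]
    simp [revHist, pathEnergy]

/-- The least priority occurring in a list is even. -/
def EvenMin {S : Type} (p : S → ℕ) (l : List S) : Prop :=
  ∃ c ∈ l, Even (p c) ∧ ∀ y ∈ l, p c ≤ p y

/-- Moving to `s` after the path `m` closes a cycle through `s`, with `r` the history of the
earlier visit, of nonnegative energy and even least priority. -/
def ClosesCycle {S : Type} {k : ℕ} (w : S → S → Fin k → ℤ) (p : S → ℕ)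
    (m : List S) (s : S) (r : List S) : Prop :=
  ∃ seg, m = seg ++ s :: r ∧ (∀ j, pathEnergy w (s :: r) j ≤ pathEnergy w (s :: m) j) ∧
    EvenMin p (seg ++ [s])

/-- No prefix of the path closes a good cycle. -/
def CycleFree {S : Type} {k : ℕ} (w : S → S → Fin k → ℤ) (p : S → ℕ) (l : List S) : Prop :=
  ∀ s m, s :: m <:+ l → ∀ r, ¬ ClosesCycle w p m s r

/-- Paths from `s0` consistent with `σ`, most recent state first. -/
def IsPath {S : Type} (isP1 : S → Prop) (E : S → S → Prop) (s0 : S) (σ : List S → S → S) :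
    List S → Prop
  | [] => True
  | [s] => s = s0
  | s :: t :: l => IsPath isP1 E s0 σ (t :: l) ∧ E t s ∧ (isP1 t → s = σ l.reverse t)

lemma IsPath.of_suffix {S : Type} {isP1 : S → Prop} {E : S → S → Prop} {s0 : S}
    {σ : List S → S → S} {l l' : List S} (h : IsPath isP1 E s0 σ l') (hs : l <:+ l') :
    IsPath isP1 E s0 σ l := by
  obtain ⟨c, rfl⟩ := hs
  induction c with
  | nil => exact h
  | cons a c ih =>
    apply ih
    rw [List.cons_append] at h
    generalize c ++ l = m at h
    cases m with
    | nil => trivial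
    | cons b m => exact h.1

lemma isPath_revHist {S : Type} {isP1 : S → Prop} {E : S → S → Prop} {s0 : S}
    {σ : List S → S → S} {π : ℕ → S} (h : ∀ n, IsPath isP1 E s0 σ (revHist π n)) :
    IsPlayFrom E s0 π ∧ Consistent1 isP1 σ π := by
  refine ⟨⟨h 1, fun i => (h (i + 2)).2.1⟩, fun n hn => ?_⟩
  rw [← reverse_revHist]
  exact (h (n + 2)).2.2 hn

/-- Every consistent path is a prefix of a consistent play. -/
lemma IsPath.exists_play {S : Type} {isP1 : S → Prop} {E : S → S → Prop} {s0 : S}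
    {σ : List S → S → S} (hE : ∀ s, ∃ t, E s t) (hσ : IsStrat1 isP1 E σ) {l0 : List S}
    (h : IsPath isP1 E s0 σ l0) :
    ∃ π, IsPlayFrom E s0 π ∧ Consistent1 isP1 σ π ∧ revHist π l0.length = l0 := by
  have hext : ∀ l, IsPath isP1 E s0 σ l → ∃ s, IsPath isP1 E s0 σ (s :: l) := by
    intro l hl
    cases l with
    | nil => exact ⟨s0, rfl⟩
    | cons t l =>
      by_cases ht : isP1 t
      · exact ⟨σ l.reverse t, hl, hσ _ _ ht, fun _ => rfl⟩
      · obtain ⟨s, hs⟩ := hE t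
        exact ⟨s, hl, hs, fun h => absurd h ht⟩
  obtain ⟨π, hπ⟩ := exists_branch
    (fun l => IsPath isP1 E s0 σ l ∧ (l <:+ l0 ∨ l0 <:+ l))
    ⟨trivial, Or.inl List.nil_suffix⟩ (by
      rintro l ⟨hl, hc⟩
      by_cases hc2 : l0 <:+ l
      · obtain ⟨s, hs⟩ := hext l hl
        exact ⟨s, hs, Or.inr (hc2.trans (List.suffix_cons s l))⟩
      · obtain ⟨c, hc⟩ := hc.resolve_right hc2
        rcases List.eq_nil_or_concat c with rfl | ⟨c, s, rfl⟩
        · exact absurd ⟨[], hc.symm⟩ hc2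
        · have hsuf : s :: l <:+ l0 := ⟨c, by simpa using hc⟩
          exact ⟨s, h.of_suffix hsuf, Or.inl hsuf⟩)
  obtain ⟨h1, h2⟩ := isPath_revHist fun n => (hπ n).1
  refine ⟨π, h1, h2, ?_⟩
  rcases (hπ l0.length).2 with hc | hc
  · exact hc.eq_of_length (length_revHist _ _)
  · exact (hc.eq_of_length (length_revHist _ _).symm).symm

lemma eventually_infOft {S : Type} [Fintype S] (π : ℕ → S) :
    ∃ K, ∀ n, K ≤ n → InfOft π (π n) := by
  have h : ∀ s, ∃ K, ¬ InfOft π s → ∀ n, K ≤ n → π n ≠ s := by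
    intro s
    by_cases hs : InfOft π s
    · exact ⟨0, fun h => absurd hs h⟩
    · have hs' := hs
      unfold InfOft at hs'
      push Not at hs'
      obtain ⟨K, hK⟩ := hs'
      exact ⟨K, fun _ => hK⟩
  choose K hK using h
  refine ⟨Finset.univ.sup K, fun n hn => ?_⟩
  by_contra hcon
  exact hK _ hcon n ((Finset.le_sup (Finset.mem_univ _)).trans hn) rfl

/-- A state realizing the parity of a play, together with a time after which no smaller
priority occurs. -/
lemma exists_min_infOft {S : Type} [Fintype S] (p : S → ℕ) (π : ℕ → S) :
    ∃ x, InfOft π x ∧ p x = sInf (p '' {s | InfOft π s}) ∧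
      ∃ K, ∀ n, K ≤ n → p x ≤ p (π n) := by
  obtain ⟨K, hK⟩ := eventually_infOft π
  obtain ⟨x, hx, hpx⟩ := Nat.sInf_mem (s := p '' {s | InfOft π s}) ⟨_, π K, hK K le_rfl, rfl⟩
  exact ⟨x, hx, hpx, K, fun n hn => hpx ▸ Nat.sInf_le ⟨π n, hK n hn, rfl⟩⟩

/-- Every winning play closes a good cycle, by Dickson's lemma. -/
lemma exists_closesCycle {S : Type} [Fintype S] {k : ℕ} (w : S → S → Fin k → ℤ) (p : S → ℕ)
    (v0 : Fin k → ℕ) (π : ℕ → S) (he : PosEnergy w v0 π) (hp : ParityWin p π) :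
    ∃ n r, ClosesCycle w p (revHist π n) (π n) r := by
  obtain ⟨x, hx, hpx, K, hK⟩ := exists_min_infOft p π
  have hfreq : ∀ N, ∃ n > N, K ≤ n ∧ π n = x := fun N => by
    obtain ⟨n, hn, hnx⟩ := hx (max (N + 1) K)
    exact ⟨n, by omega, by omega, hnx⟩
  obtain ⟨φ, hφ, hφx⟩ := Nat.exists_strictMono_subsequence hfreq
  obtain ⟨a, b, hab, hle⟩ := wellQuasiOrdered_le
    (fun n (j : Fin k) => ((v0 j : ℤ) + EL w π (φ n) j).toNat)
  have hlt := hφ hab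
  obtain ⟨seg, hseg, hy⟩ := revHist_split π (Nat.succ_le_of_lt hlt)
  have hxab : π (φ b) = π (φ a) := (hφx b).2.trans (hφx a).2.symm
  refine ⟨φ b, revHist π (φ a), seg, by rw [hseg, hxab]; rfl, fun j => ?_, ?_⟩
  · have e1 := pathEnergy_revHist w π (φ a) j
    have e2 := pathEnergy_revHist w π (φ b) j
    simp only [revHist] at e1 e2
    rw [e2, hxab, e1]
    have h1 := hle j
    have h2 := he (φ a) j
    have h3 := he (φ b) j
    simp only at h1
    omega
  · rw [(hφx b).2]
    refine ⟨x, by simp, by rw [hpx]; exact hp, fun y hmem => ?_⟩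
    rcases List.mem_append.1 hmem with hmem | hmem
    · obtain ⟨t, ht, rfl⟩ := hy y hmem
      exact hK t (by have := (hφx a).1; omega)
    · rw [List.mem_singleton.1 hmem]

lemma exists_liminf {u : ℕ → ℕ} {N : ℕ} (hu : ∀ n, u n ≤ N) :
    ∃ d, (∀ K, ∃ n, K ≤ n ∧ u n ≤ d) ∧ ∃ K, ∀ n, K ≤ n → d ≤ u n := by
  classical
  have hex : ∃ d, ∀ K, ∃ n, K ≤ n ∧ u n ≤ d := ⟨N, fun K => ⟨K, le_rfl, hu K⟩⟩
  refine ⟨Nat.find hex, Nat.find_spec hex, ?_⟩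
  rcases h : Nat.find hex with _ | e
  · exact ⟨0, fun _ _ => Nat.zero_le _⟩
  · have := Nat.find_min hex (m := e) (by omega)
    push Not at this
    exact this

/-- If a play is tracked by a stack of bounded height, which is popped only along segments
whose least priority is even, then the play satisfies the parity objective. -/
lemma parityWin_of_stack {S : Type} [Fintype S] (p : S → ℕ) (π : ℕ → S) (r : ℕ → List S)
    {N : ℕ} (hN : ∀ n, (r n).length ≤ N)
    (hstep : ∀ n, r (n + 1) = π n :: r n ∨
      ∃ seg, π n :: r n = seg ++ π (n + 1) :: r (n + 1) ∧ EvenMin p (seg ++ [π (n + 1)])) :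
    ParityWin p π := by
  obtain ⟨x, hx, hpx, K, hK⟩ := exists_min_infOft p π
  obtain ⟨d, hd, K', hK'⟩ := exists_liminf hN
  obtain ⟨t0, ht0, hdt⟩ := hd (max K K')
  have hbase : ∀ n, t0 ≤ n → ∃ A, π n :: r n = A ++ r t0 ∧ ∀ y ∈ A, p x ≤ p y := by
    intro n hn
    induction n, hn using Nat.le_induction with
    | base =>
      refine ⟨[π t0], rfl, fun y hy => ?_⟩
      rw [List.mem_singleton.1 hy]
      exact hK _ (by omega)
    | succ n hn ih =>
      obtain ⟨A, hA, hy⟩ := ih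
      rcases hstep n with h | ⟨seg, h, -⟩
      · refine ⟨π (n + 1) :: A, by rw [h, hA]; rfl, fun y hmem => ?_⟩
        rcases List.mem_cons.1 hmem with rfl | hmem
        · exact hK _ (by omega)
        · exact hy y hmem
      · have hsuf : r t0 <:+ π (n + 1) :: r (n + 1) := by
          refine List.suffix_of_suffix_length_le (l₃ := π n :: r n) ⟨A, hA.symm⟩
            ⟨seg, h.symm⟩ ?_
          have := hK' (n + 1) (by omega)
          simp only [List.length_cons]
          omega
        obtain ⟨B, hB⟩ := hsuf
        refine ⟨B, hB.symm, fun y hmem => hy y ?_⟩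
        rw [hA, ← hB, ← List.append_assoc] at h
        rw [List.append_cancel_right h]
        simp [hmem]
  obtain ⟨n1, hn1, rfl⟩ := hx t0
  by_contra hodd
  have hpush : ∀ n, n1 ≤ n → π n1 :: r n1 <:+ π n :: r n → π n1 :: r n1 <:+ r (n + 1) := by
    intro n hn hsuf
    rcases hstep n with h | ⟨seg, h, c, hc, hev, hmin⟩
    · rwa [h]
    · rcases le_or_gt (π n1 :: r n1).length (r (n + 1)).length with hl | hl
      · exact List.suffix_of_suffix_length_le hsuf ⟨seg ++ [π (n + 1)], by simp [h]⟩ hl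
      · exfalso
        obtain ⟨A, hA, hy⟩ := hbase n (hn1.trans hn)
        obtain ⟨D, hD⟩ : π (n + 1) :: r (n + 1) <:+ π n1 :: r n1 :=
          List.suffix_of_suffix_length_le ⟨seg, h.symm⟩ hsuf hl
        obtain ⟨B, hB⟩ : r t0 <:+ r (n + 1) := by
          refine List.suffix_of_suffix_length_le (l₃ := π n :: r n) ⟨A, hA.symm⟩
            ⟨seg ++ [π (n + 1)], by simp [h]⟩ ?_
          have := hK' (n + 1) (by omega)
          omega
        have hxmem : π n1 ∈ seg ++ [π (n + 1)] := by
          cases D with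
          | nil => simp [(List.cons.inj hD).1]
          | cons y D =>
            obtain ⟨C, hC⟩ := hsuf
            have hseg : C ++ y :: D = seg := by
              rw [h, ← hD, ← List.append_assoc] at hC
              exact List.append_cancel_right hC
            have hyx : y = π n1 := (List.cons.inj hD).1
            simp [← hseg, hyx]
        have hcA : c ∈ A := by
          have hsegA : seg ++ [π (n + 1)] ++ B = A := by
            apply List.append_cancel_right (bs := r t0)
            rw [← hA, h, ← hB]
            simp
          rw [← hsegA]
          exact List.mem_append_left _ hc
        apply hodd
        rw [ParityWin, ← hpx, le_antisymm (hy c hcA) (hmin _ hxmem)]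
        exact hev
  have hkeep : ∀ n, n1 + 1 ≤ n → π n1 :: r n1 <:+ r n := by
    intro n hn
    induction n, hn using Nat.le_induction with
    | base => exact hpush n1 le_rfl List.suffix_rfl
    | succ n hn ih => exact hpush n (by omega) (ih.trans (List.suffix_cons _ _))
  obtain ⟨n, hn, hnd⟩ := hd (n1 + 1)
  have h1 := (hkeep n hn).length_le
  have h2 := hK' n1 (by omega)
  simp only [List.length_cons] at h1
  omega

/-- if player 1 has a (possibly infinite-memory) pure winning strategy in a
multi energy parity game, then he has a pure finite-memory winning strategy. -/
theorem finite_memory_suffices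
    {S : Type} [Fintype S] (isP1 : S → Prop) (sinit : S)
    (E : S → S → Prop) (hE : ∀ s, ∃ t, E s t)
    (k : ℕ) (w : S → S → Fin k → ℤ) (p : S → ℕ)
    (hwin : ∃ (v0 : Fin k → ℕ) (σ : List S → S → S), IsStrat1 isP1 E σ ∧
      ∀ π : ℕ → S, IsPlayFrom E sinit π → Consistent1 isP1 σ π →
        PosEnergy w v0 π ∧ ParityWin p π) :
    ∃ (v0' : Fin k → ℕ) (M : Type) (_ : Fintype M) (m0 : M)
      (αu : M → S → M) (αn : M → S → S),
      IsStrat1 isP1 E (MooreStrat m0 αu αn) ∧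
      ∀ π : ℕ → S, IsPlayFrom E sinit π →
        Consistent1 isP1 (MooreStrat m0 αu αn) π →
        PosEnergy w v0' π ∧ ParityWin p π := by
  classical
  obtain ⟨v0, σ, hσ, hwin⟩ := hwin
  let T : List S → Prop := fun l => IsPath isP1 E sinit σ l ∧ CycleFree w p l
  have hTsuf : ∀ l l', T l' → l <:+ l' → T l := fun l l' h hs =>
    ⟨h.1.of_suffix hs, fun s m hm => h.2 s m (hm.trans hs)⟩
  have hfin : {l | T l}.Finite := by
    by_contra hinf
    obtain ⟨π, hπ⟩ := exists_branch_of_infinite T hTsuf hinf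
    obtain ⟨h1, h2⟩ := isPath_revHist fun n => (hπ n).1
    obtain ⟨h3, h4⟩ := hwin π h1 h2
    obtain ⟨n, r, hr⟩ := exists_closesCycle w p v0 π h3 h4
    exact (hπ (n + 1)).2 _ _ List.suffix_rfl r hr
  have hred : ∀ m s, ∃ r, ClosesCycle w p m s r ∨ (r = m ∧ ∀ r', ¬ ClosesCycle w p m s r') := by
    intro m s
    by_cases h : ∃ r, ClosesCycle w p m s r
    · exact ⟨h.choose, Or.inl h.choose_spec⟩
    · exact ⟨m, Or.inr ⟨rfl, not_exists.1 h⟩⟩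
  choose red hred using hred
  have hT0 : T [] := ⟨trivial, fun s m hm => by simp at hm⟩
  have hTstep : ∀ m s, T m → IsPath isP1 E sinit σ (s :: m) → T (s :: red m s) := by
    intro m s hm hpath
    rcases hred m s with ⟨seg, h, -⟩ | ⟨h, hnot⟩
    · exact hTsuf _ m hm ⟨seg, h.symm⟩
    · rw [h]
      refine ⟨hpath, fun s' m' hsuf => ?_⟩
      rcases List.suffix_cons_iff.1 hsuf with heq | hsuf
      · obtain ⟨rfl, rfl⟩ := List.cons.inj heq
        exact hnot
      · exact hm.2 s' m' hsuf
  let αu : {l // T l} → S → {l // T l} := fun m s =>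
    if h : T (s :: red m.1 s) then ⟨_, h⟩ else m
  let αn : {l // T l} → S → S := fun m s => σ (red m.1 s).reverse s
  refine ⟨v0, {l // T l}, hfin.fintype, ⟨[], hT0⟩, αu, αn, fun h s hs => hσ _ s hs, ?_⟩
  intro π hplay hcons
  let mem : ℕ → {l // T l} := fun n => (Hist π n).foldl αu ⟨[], hT0⟩
  let r : ℕ → List S := fun n => red (mem n).1 (π n)
  have hmem : ∀ n, mem (n + 1) = αu (mem n) (π n) := fun n => by
    simp [mem, Hist, List.range_succ]
  have hmemT : ∀ n, T (π n :: r n) → (mem (n + 1)).1 = π n :: r n := fun n hn => by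
    rw [hmem]
    simp only [αu]
    rw [dif_pos hn]
  have hpath : ∀ n, T (π n :: r n) → IsPath isP1 E sinit σ (π (n + 1) :: π n :: r n) :=
    fun n hn => ⟨hn.1, hplay.2 n, fun h1 => hcons n h1⟩
  have hTn : ∀ n, T (π n :: r n) := by
    intro n
    induction n with
    | zero => exact hTstep _ _ hT0 hplay.1
    | succ n ih =>
      refine hTstep _ _ (mem (n + 1)).2 ?_
      rw [hmemT n ih]
      exact hpath n ih
  have hstep : ∀ n, ClosesCycle w p (π n :: r n) (π (n + 1)) (r (n + 1)) ∨
      r (n + 1) = π n :: r n := fun n => by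
    have h := hred (mem (n + 1)).1 (π (n + 1))
    rw [hmemT n (hTn n)] at h
    have hr : r (n + 1) = red (π n :: r n) (π (n + 1)) := by
      rw [← hmemT n (hTn n)]
    rw [hr]
    exact h.imp id And.left
  constructor
  · intro n j
    have hle : pathEnergy w (π n :: r n) j ≤ EL w π n j := by
      induction n with
      | zero =>
        rcases hred (mem 0).1 (π 0) with ⟨seg, h, -⟩ | ⟨h, -⟩
        · simp [mem, Hist] at h
        · have hr : r 0 = [] := h
          simp [hr, pathEnergy, EL]
      | succ n ih =>
        have hcons : pathEnergy w (π (n + 1) :: π n :: r n) j ≤ EL w π (n + 1) j := by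
          rw [EL, Finset.sum_range_succ, ← EL]
          simpa [pathEnergy] using ih
        rcases hstep n with ⟨seg, -, h, -⟩ | h
        · exact (h j).trans hcons
        · rwa [h]
    obtain ⟨π', h1, h2, h3⟩ := (hTn n).1.exists_play hE hσ
    have h4 := (hwin π' h1 h2).1 (r n).length j
    rw [← pathEnergy_revHist] at h4
    rw [List.length_cons] at h3
    rw [h3] at h4
    omega
  · obtain ⟨N, hN⟩ := (hfin.image List.length).bddAbove
    refine parityWin_of_stack p π r (N := N) (fun n => ?_) fun n => ?_
    · have := hN ⟨_, hTn n, rfl⟩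
      simp only [List.length_cons] at this
      omega
    · rcases hstep n with ⟨seg, h, -, hev⟩ | h
      · exact Or.inr ⟨seg, h, hev⟩
      · exact Or.inl h

end Stmt0
end

section
/- In a multi energy parity game, if player P₂ has a spoiling strategy — a pure strategy λ₂ such that for every initial credit v₀ ∈ ℕ^k and every pure strategy λ₁ of P₁, the outcome of λ₁ and λ₂ does not belong to PosEnergy(v₀) ∩ Parity — then P₂ has a pure memoryless spoiling strategy, i.e., one depending only on the current state. -/
namespace Stmt1

def IsPlayFrom {S : Type} (E : S → S → Prop) (s0 : S) (π : ℕ → S) : Prop :=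
  π 0 = s0 ∧ ∀ i, E (π i) (π (i + 1))

def EL {S : Type} {k : ℕ} (w : S → S → Fin k → ℤ) (π : ℕ → S) (n : ℕ) (j : Fin k) : ℤ :=
  ∑ i ∈ Finset.range n, w (π i) (π (i + 1)) j

def PosEnergy {S : Type} {k : ℕ} (w : S → S → Fin k → ℤ) (v0 : Fin k → ℕ) (π : ℕ → S) :
    Prop :=
  ∀ n j, 0 ≤ (v0 j : ℤ) + EL w π n j

def InfOft {S : Type} (π : ℕ → S) (s : S) : Prop :=
  ∀ N, ∃ n, N ≤ n ∧ π n = s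

def ParityWin {S : Type} (p : S → ℕ) (π : ℕ → S) : Prop :=
  Even (sInf (p '' {s | InfOft π s}))

def IsStrat1 {S : Type} (isP1 : S → Prop) (E : S → S → Prop) (σ : List S → S → S) : Prop :=
  ∀ h s, isP1 s → E s (σ h s)

/-- Legality for a strategy of player 2 (who owns the states where `¬ isP1`). -/
def IsStrat2 {S : Type} (isP1 : S → Prop) (E : S → S → Prop) (σ : List S → S → S) : Prop :=
  ∀ h s, ¬ isP1 s → E s (σ h s)

def Hist {S : Type} (π : ℕ → S) (n : ℕ) : List S := (List.range n).map π

def Consistent1 {S : Type} (isP1 : S → Prop) (σ : List S → S → S) (π : ℕ → S) : Prop :=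
  ∀ n, isP1 (π n) → π (n + 1) = σ (Hist π n) (π n)

def Consistent2 {S : Type} (isP1 : S → Prop) (σ : List S → S → S) (π : ℕ → S) : Prop :=
  ∀ n, ¬ isP1 (π n) → π (n + 1) = σ (Hist π n) (π n)

open Filter

/-- The sequence of edges traversed by a play. -/
def edgeSeq {S : Type} (π : ℕ → S) (n : ℕ) : S × S := (π n, π (n + 1))

/-- A prefix-independent condition that is closed under shuffling two sequences. -/
structure IsShuffleClosed {α : Type} (W : Set (ℕ → α)) : Prop where
  shift_mem_iff : ∀ (u : ℕ → α) (N : ℕ), (fun n => u (n + N)) ∈ W ↔ u ∈ W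
  mem_of_shuffle : ∀ (u : ℕ → α) (A : ℕ → Prop), {n | A n}.Infinite →
    {n | ¬ A n}.Infinite → (fun i => u (Nat.nth A i)) ∈ W →
    (fun i => u (Nat.nth (fun n => ¬ A n) i)) ∈ W → u ∈ W

/-- A graph over the arena that offers player 1 a move at each of his nodes, follows every move of
player 2, and all of whose infinite paths satisfy `W`. -/
structure StrategyGraph {S : Type} (isP1 : S → Prop) (E : S → S → Prop)
    (W : Set (ℕ → S × S)) where
  Node : Type
  pos : Node → S
  Step : Node → Node → Prop
  edge_of_step : ∀ q q', Step q q' → E (pos q) (pos q')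
  exists_step : ∀ q, isP1 (pos q) → ∃ q', Step q q'
  follow : ∀ q, ¬ isP1 (pos q) → ∀ y, E (pos q) y → ∃ q', Step q q' ∧ pos q' = y
  path_mem : ∀ ρ : ℕ → Node, (∀ n, Step (ρ n) (ρ (n + 1))) → edgeSeq (fun n => pos (ρ n)) ∈ W

/-- Player 1 has a strategy graph for `W` with a node at `t`. -/
def P1Wins {S : Type} (isP1 : S → Prop) (E : S → S → Prop) (W : Set (ℕ → S × S)) (t : S) :
    Prop :=
  ∃ (X : StrategyGraph isP1 E W) (q : X.Node), X.pos q = t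

/-- Player 2 has a memoryless strategy none of whose plays from `t` satisfies `W`. -/
def P2WinsMemoryless {S : Type} (isP1 : S → Prop) (E : S → S → Prop) (W : Set (ℕ → S × S))
    (t : S) : Prop :=
  ∃ f : S → S, (∀ s, ¬ isP1 s → E s (f s)) ∧
    ∀ π : ℕ → S, IsPlayFrom E t π → (∀ n, ¬ isP1 (π n) → π (n + 1) = f (π n)) → edgeSeq π ∉ W

lemma eq_of_stutter {Q : Type} {A : ℕ → Prop} {a : ℕ → Q} (hstay : ∀ n, ¬ A n → a (n + 1) = a n)
    {m n : ℕ} (hmn : m ≤ n) (h : ∀ i, m ≤ i → i < n → ¬ A i) : a n = a m := by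
  induction n, hmn using Nat.le_induction with
  | base => rfl
  | succ n hmn ih =>
    rw [hstay n (h n hmn (Nat.lt_succ_self n)), ih fun i hi hin => h i hi (by omega)]

lemma StrategyGraph.nth_mem {S : Type} {isP1 : S → Prop} {E : S → S → Prop}
    {W : Set (ℕ → S × S)} (X : StrategyGraph isP1 E W) {A : ℕ → Prop} {a : ℕ → X.Node}
    {u : ℕ → S × S} (hA : {n | A n}.Infinite) (hstep : ∀ n, A n → X.Step (a n) (a (n + 1)))
    (hstay : ∀ n, ¬ A n → a (n + 1) = a n)
    (hu : ∀ n, A n → u n = (X.pos (a n), X.pos (a (n + 1)))) :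
    (fun i => u (Nat.nth A i)) ∈ W := by
  have hnext : ∀ i, a (Nat.nth A (i + 1)) = a (Nat.nth A i + 1) := fun i =>
    eq_of_stutter hstay ((Nat.nth_strictMono hA) (Nat.lt_succ_self i)) fun j hj hj' hAj =>
      absurd (Nat.le_nth_of_lt_nth_succ hj' hAj) (by omega)
  have hmem := X.path_mem (fun i => a (Nat.nth A i)) fun i => by
    rw [hnext]
    exact hstep _ (Nat.nth_mem_of_infinite hA i)
  convert hmem using 1
  funext i
  simp only [edgeSeq, hnext, hu _ (Nat.nth_mem_of_infinite hA i)]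

lemma StrategyGraph.mem_of_forall_ge {S : Type} {isP1 : S → Prop} {E : S → S → Prop}
    {W : Set (ℕ → S × S)} (hW : IsShuffleClosed W) (X : StrategyGraph isP1 E W)
    {a : ℕ → X.Node} {u : ℕ → S × S} {N : ℕ}
    (hstep : ∀ n, N ≤ n → X.Step (a n) (a (n + 1)))
    (hu : ∀ n, N ≤ n → u n = (X.pos (a n), X.pos (a (n + 1)))) : u ∈ W := by
  rw [← hW.shift_mem_iff u N]
  have hmem := X.path_mem (fun n => a (n + N)) fun n => by
    simpa only [Nat.add_right_comm] using hstep (n + N) (by omega)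
  convert hmem using 1
  funext n
  simp only [edgeSeq, hu (n + N) (by omega), Nat.add_right_comm]

lemma exists_forall_ge_not {A : ℕ → Prop} (hA : ¬ {n | A n}.Infinite) :
    ∃ N, ∀ n, N ≤ n → ¬ A n := by
  obtain ⟨N, hN⟩ := (Set.not_infinite.1 hA).bddAbove
  exact ⟨N + 1, fun n hn h => absurd (hN h) (by omega)⟩

open Classical in
/-- Two strategy graphs for arenas that differ only at a state `x` combine to one for
the union of the arenas: the play in one of the graphs is suspended at `x` while moves
of the other are played. -/
lemma p1Wins_of_split {S : Type} {isP1 : S → Prop} {E EL ER : S → S → Prop}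
    {W : Set (ℕ → S × S)} (hW : IsShuffleClosed W) {x t : S}
    (hEL : ∀ u v, EL u v → E u v) (hER : ∀ u v, ER u v → E u v)
    (hE : ∀ u v, E u v → EL u v ∨ ER u v)
    (hELne : ∀ u v, u ≠ x → E u v → EL u v) (hERne : ∀ u v, u ≠ x → E u v → ER u v)
    (hL : P1Wins isP1 EL W t) (hR : P1Wins isP1 ER W x) : P1Wins isP1 E W t := by
  obtain ⟨X, a₀, ha₀⟩ := hL
  obtain ⟨Y, b₀, hb₀⟩ := hR
  let pos : {q : X.Node × Y.Node // X.pos q.1 = x ∨ Y.pos q.2 = x} → S :=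
    fun q => if Y.pos q.1.2 = x then X.pos q.1.1 else Y.pos q.1.2
  have posX : ∀ q, Y.pos q.1.2 = x → pos q = X.pos q.1.1 := fun q h => if_pos h
  have posY : ∀ q, X.pos q.1.1 = x → pos q = Y.pos q.1.2 := fun q h => by
    by_cases hb : Y.pos q.1.2 = x
    · rw [posX q hb, h, hb]
    · exact if_neg hb
  let moveX : {q : X.Node × Y.Node // X.pos q.1 = x ∨ Y.pos q.2 = x} →
      {q : X.Node × Y.Node // X.pos q.1 = x ∨ Y.pos q.2 = x} → Prop :=
    fun q q' => Y.pos q.1.2 = x ∧ X.Step q.1.1 q'.1.1 ∧ q'.1.2 = q.1.2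
  let moveY : {q : X.Node × Y.Node // X.pos q.1 = x ∨ Y.pos q.2 = x} →
      {q : X.Node × Y.Node // X.pos q.1 = x ∨ Y.pos q.2 = x} → Prop :=
    fun q q' => X.pos q.1.1 = x ∧ Y.Step q.1.2 q'.1.2 ∧ q'.1.1 = q.1.1
  have pos_moveX : ∀ q q', moveX q q' → pos q = X.pos q.1.1 ∧ pos q' = X.pos q'.1.1 :=
    fun q q' h => ⟨posX q h.1, posX q' (by rw [h.2.2, h.1])⟩
  have pos_moveY : ∀ q q', moveY q q' → pos q = Y.pos q.1.2 ∧ pos q' = Y.pos q'.1.2 :=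
    fun q q' h => ⟨posY q h.1, posY q' (by rw [h.2.2, h.1])⟩
  refine ⟨⟨{q : X.Node × Y.Node // X.pos q.1 = x ∨ Y.pos q.2 = x}, pos,
    fun q q' => moveX q q' ∨ moveY q q', ?_, ?_, ?_, ?_⟩, ⟨(a₀, b₀), Or.inr hb₀⟩,
    (posX _ hb₀).trans ha₀⟩
  · rintro q q' (h | h)
    · rw [(pos_moveX q q' h).1, (pos_moveX q q' h).2]
      exact hEL _ _ (X.edge_of_step _ _ h.2.1)
    · rw [(pos_moveY q q' h).1, (pos_moveY q q' h).2]
      exact hER _ _ (Y.edge_of_step _ _ h.2.1)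
  · rintro q hq
    rcases q.2 with h | h
    · obtain ⟨b', hb'⟩ := Y.exists_step q.1.2 (posY q h ▸ hq)
      exact ⟨⟨(q.1.1, b'), Or.inl h⟩, Or.inr ⟨h, hb', rfl⟩⟩
    · obtain ⟨a', ha'⟩ := X.exists_step q.1.1 (posX q h ▸ hq)
      exact ⟨⟨(a', q.1.2), Or.inr h⟩, Or.inl ⟨h, ha', rfl⟩⟩
  · intro q hq y hy
    have followX : Y.pos q.1.2 = x → EL (pos q) y →
        ∃ q', (moveX q q' ∨ moveY q q') ∧ pos q' = y := by
      intro h hy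
      rw [posX q h] at hq hy
      obtain ⟨a', ha', hpos⟩ := X.follow q.1.1 hq y hy
      exact ⟨⟨(a', q.1.2), Or.inr h⟩, Or.inl ⟨h, ha', rfl⟩,
        (posX ⟨(a', q.1.2), Or.inr h⟩ h).trans hpos⟩
    have followY : X.pos q.1.1 = x → ER (pos q) y →
        ∃ q', (moveX q q' ∨ moveY q q') ∧ pos q' = y := by
      intro h hy
      rw [posY q h] at hq hy
      obtain ⟨b', hb', hpos⟩ := Y.follow q.1.2 hq y hy
      exact ⟨⟨(q.1.1, b'), Or.inl h⟩, Or.inr ⟨h, hb', rfl⟩,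
        (posY ⟨(q.1.1, b'), Or.inl h⟩ h).trans hpos⟩
    rcases q.2 with h | h
    · by_cases hb : Y.pos q.1.2 = x
      · exact (hE _ _ hy).elim (followX hb) (followY h)
      · exact followY h (hERne _ _ (by rwa [posY q h]) hy)
    · by_cases ha : X.pos q.1.1 = x
      · exact (hE _ _ hy).elim (followX h) (followY ha)
      · exact followX h (hELne _ _ (by rwa [posX q h]) hy)
  · intro ρ hρ
    let A : ℕ → Prop := fun n => moveX (ρ n) (ρ (n + 1))
    have hB : ∀ n, ¬ A n → moveY (ρ n) (ρ (n + 1)) := fun n hn => (hρ n).resolve_left hn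
    have huX : ∀ n, A n → edgeSeq (fun n => pos (ρ n)) n =
        (X.pos (ρ n).1.1, X.pos (ρ (n + 1)).1.1) := fun n hn =>
      Prod.ext (pos_moveX _ _ hn).1 (pos_moveX _ _ hn).2
    have huY : ∀ n, ¬ A n → edgeSeq (fun n => pos (ρ n)) n =
        (Y.pos (ρ n).1.2, Y.pos (ρ (n + 1)).1.2) := fun n hn =>
      Prod.ext (pos_moveY _ _ (hB n hn)).1 (pos_moveY _ _ (hB n hn)).2
    by_cases hA : {n | A n}.Infinite
    · by_cases hA' : {n | ¬ A n}.Infinite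
      · exact hW.mem_of_shuffle _ A hA hA'
          (X.nth_mem (a := fun n => (ρ n).1.1) hA (fun n hn => hn.2.1)
            (fun n hn => (hB n hn).2.2) huX)
          (Y.nth_mem (a := fun n => (ρ n).1.2) hA' (fun n hn => (hB n hn).2.1)
            (fun n hn => (not_not.1 hn).2.2) huY)
      · obtain ⟨N, hN⟩ := exists_forall_ge_not hA'
        exact X.mem_of_forall_ge hW (a := fun n => (ρ n).1.1)
          (fun n hn => (not_not.1 (hN n hn)).2.1) fun n hn => huX n (not_not.1 (hN n hn))
    · obtain ⟨N, hN⟩ := exists_forall_ge_not hA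
      exact Y.mem_of_forall_ge hW (a := fun n => (ρ n).1.2)
        (fun n hn => (hB n (hN n hn)).2.1) fun n hn => huY n (hN n hn)

lemma P2WinsMemoryless.mono {S : Type} {isP1 : S → Prop} {E E' : S → S → Prop}
    {W : Set (ℕ → S × S)} {t : S} (h : P2WinsMemoryless isP1 E' W t)
    (hle : ∀ u v, E' u v → E u v) (hP1 : ∀ u v, isP1 u → E u v → E' u v) :
    P2WinsMemoryless isP1 E W t := by
  obtain ⟨f, hf, hwin⟩ := h
  refine ⟨f, fun s hs => hle _ _ (hf s hs), fun π hπ hcons => hwin π ⟨hπ.1, fun i => ?_⟩ hcons⟩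
  by_cases hi : isP1 (π i)
  · exact hP1 _ _ hi (hπ.2 i)
  · rw [hcons i hi]
    exact hf _ hi

lemma P1Wins.of_avoid {S : Type} {isP1 : S → Prop} {E E' : S → S → Prop}
    {W : Set (ℕ → S × S)} {x t : S} (h : P1Wins isP1 E' W t) (hx : ¬ P1Wins isP1 E' W x)
    (hle : ∀ u v, E' u v → E u v) (hne : ∀ u v, u ≠ x → E u v → E' u v) :
    P1Wins isP1 E W t := by
  obtain ⟨X, q, hq⟩ := h
  exact ⟨⟨X.Node, X.pos, X.Step, fun q q' h => hle _ _ (X.edge_of_step q q' h), X.exists_step,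
    fun q hq y hy => X.follow q hq y (hne _ _ (fun h => hx ⟨X, q, h⟩) hy), X.path_mem⟩, q, hq⟩

lemma p1Wins_or_p2WinsMemoryless_of_unique {S : Type} {isP1 : S → Prop} {E : S → S → Prop}
    {W : Set (ℕ → S × S)} (hW : IsShuffleClosed W) (hE : ∀ s, ∃ t, E s t)
    (huniq : ∀ s, ¬ isP1 s → ∀ y z, E s y → E s z → y = z) (t : S) :
    P1Wins isP1 E W t ∨ P2WinsMemoryless isP1 E W t := by
  choose f hf using hE
  by_cases h : ∃ π, IsPlayFrom E t π ∧ edgeSeq π ∈ W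
  · obtain ⟨π, hπ, hmem⟩ := h
    refine Or.inl ⟨⟨ℕ, π, fun n m => m = n + 1, ?_, fun q _ => ⟨q + 1, rfl⟩, ?_, ?_⟩, 0, hπ.1⟩
    · rintro q _ rfl
      exact hπ.2 q
    · exact fun q hq y hy => ⟨q + 1, rfl, huniq _ hq _ _ (hπ.2 q) hy⟩
    · intro ρ hρ
      have hval : ∀ n, ρ n = n + ρ 0 := fun n => by
        induction n with
        | zero => simp
        | succ n ih => rw [hρ, ih, Nat.add_right_comm]
      convert (hW.shift_mem_iff _ (ρ 0)).2 hmem using 1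
      funext n
      simp only [edgeSeq, hval n, hval (n + 1), Nat.add_right_comm]
  · exact Or.inr ⟨f, fun s _ => hf s, fun π hπ _ hmem => h ⟨π, hπ, hmem⟩⟩

/-- On finite arenas, games with a shuffle-closed objective for player 1 are determined, with
memoryless winning strategies for player 2. -/
theorem p1Wins_or_p2WinsMemoryless {S : Type} [Finite S] {isP1 : S → Prop}
    {W : Set (ℕ → S × S)} (hW : IsShuffleClosed W) (E : S → S → Prop) (hE : ∀ s, ∃ t, E s t)
    (t : S) : P1Wins isP1 E W t ∨ P2WinsMemoryless isP1 E W t := by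
  induction E using WellFoundedLT.induction generalizing t with
  | ind E ih =>
  by_cases huniq : ∀ s, ¬ isP1 s → ∀ y z, E s y → E s z → y = z
  · exact p1Wins_or_p2WinsMemoryless_of_unique hW hE huniq t
  push Not at huniq
  obtain ⟨x, hx, y, z, hy, hz, hyz⟩ := huniq
  let L : S → S → Prop := fun u v => E u v ∧ (u = x → v = y)
  let R : S → S → Prop := fun u v => E u v ∧ (u = x → v ≠ y)
  have hLt : L < E := lt_of_le_of_ne (fun u v h => h.1) fun h =>
    hyz (((congrFun (congrFun h x) z).mpr hz).2 rfl).symm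
  have hRt : R < E := lt_of_le_of_ne (fun u v h => h.1) fun h =>
    ((congrFun (congrFun h x) y).mpr hy).2 rfl rfl
  have hLne : ∀ u v, u ≠ x → E u v → L u v := fun u v hu h => ⟨h, fun hux => absurd hux hu⟩
  have hRne : ∀ u v, u ≠ x → E u v → R u v := fun u v hu h => ⟨h, fun hux => absurd hux hu⟩
  have hne : ∀ u, isP1 u → u ≠ x := fun u hu hux => hx (hux ▸ hu)
  have hLtot : ∀ s, ∃ t, L s t := fun s => by
    by_cases hs : s = x
    · exact ⟨y, hs ▸ hy, fun _ => rfl⟩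
    · exact (hE s).imp fun v hv => hLne s v hs hv
  have hRtot : ∀ s, ∃ t, R s t := fun s => by
    by_cases hs : s = x
    · exact ⟨z, hs ▸ hz, fun _ => hyz.symm⟩
    · exact (hE s).imp fun v hv => hRne s v hs hv
  by_cases hRx : P1Wins isP1 R W x
  · rcases ih L hLt hLtot t with h | h
    · refine Or.inl (p1Wins_of_split hW (fun _ _ h => h.1) (fun _ _ h => h.1) (fun u v h => ?_)
        hLne hRne h hRx)
      by_cases hv : v = y
      · exact Or.inl ⟨h, fun _ => hv⟩
      · exact Or.inr ⟨h, fun _ => hv⟩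
    · exact Or.inr (h.mono (fun _ _ h => h.1) fun u v hu => hLne u v (hne u hu))
  · rcases ih R hRt hRtot t with h | h
    · exact Or.inl (h.of_avoid hRx (fun _ _ h => h.1) hRne)
    · exact Or.inr (h.mono (fun _ _ h => h.1) fun u v hu => hRne u v (hne u hu))

/-- Edge sequences whose energy is bounded below and whose least recurring priority is even. -/
def energyParity {S : Type} {k : ℕ} (w : S → S → Fin k → ℤ) (p : S → ℕ) : Set (ℕ → S × S) :=
  {u | (∀ j, ∃ B : ℤ, ∀ n, B ≤ ∑ i ∈ Finset.range n, w (u i).1 (u i).2 j) ∧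
    ∃ d, Even d ∧ (∃ᶠ n in atTop, p (u n).1 = d) ∧ ∀ᶠ n in atTop, d ≤ p (u n).1}

lemma exists_lowerBound_shift_iff (x : ℕ → ℤ) (N : ℕ) :
    (∃ B : ℤ, ∀ n, B ≤ ∑ i ∈ Finset.range n, x (i + N)) ↔
      ∃ B : ℤ, ∀ n, B ≤ ∑ i ∈ Finset.range n, x i := by
  have hsum : ∀ n, ∑ i ∈ Finset.range (N + n), x i =
      ∑ i ∈ Finset.range N, x i + ∑ i ∈ Finset.range n, x (i + N) := fun n => by
    rw [Finset.sum_range_add]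
    simp only [Nat.add_comm]
  constructor
  · rintro ⟨B, hB⟩
    obtain ⟨C, hC⟩ := ((Finset.range (N + 1)).image fun n => ∑ i ∈ Finset.range n, x i).bddBelow
    refine ⟨min C (∑ i ∈ Finset.range N, x i + B), fun n => ?_⟩
    rcases le_total n N with h | h
    · exact min_le_of_left_le (hC (Finset.mem_coe.2 (Finset.mem_image_of_mem _
        (Finset.mem_range.2 (by omega)))))
    · obtain ⟨m, rfl⟩ := Nat.exists_eq_add_of_le h
      rw [hsum]
      exact min_le_of_right_le (by linarith [hB m])
  · rintro ⟨B, hB⟩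
    exact ⟨B - ∑ i ∈ Finset.range N, x i, fun n => by linarith [hB (N + n), hsum n]⟩

open Classical in
lemma sum_range_eq_sum_nth_add_sum_nth_not (x : ℕ → ℤ) (A : ℕ → Prop) (n : ℕ) :
    ∑ i ∈ Finset.range n, x i = ∑ i ∈ Finset.range (Nat.count A n), x (Nat.nth A i) +
      ∑ i ∈ Finset.range (Nat.count (fun m => ¬ A m) n), x (Nat.nth (fun m => ¬ A m) i) := by
  induction n with
  | zero => simp
  | succ n ih =>
    rw [Finset.sum_range_succ, ih, Nat.count_succ, Nat.count_succ]
    by_cases h : A n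
    · simp only [h, if_true, not_true, if_false, add_zero, Finset.sum_range_succ, Nat.nth_count h]
      ring
    · have h' := Nat.nth_count (p := fun m => ¬ A m) h
      simp only [h, if_false, not_false_iff, if_true, add_zero, Finset.sum_range_succ, h']
      ring

open Classical in
lemma eventually_of_eventually_nth {A P : ℕ → Prop} (hA : {n | A n}.Infinite)
    (h : ∀ᶠ i in atTop, P (Nat.nth A i)) : ∀ᶠ n in atTop, A n → P n := by
  obtain ⟨N, hN⟩ := eventually_atTop.1 h
  refine eventually_atTop.2 ⟨Nat.nth A N, fun n hn hAn => ?_⟩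
  rw [← Nat.nth_count hAn]
  refine hN _ ?_
  rw [← Nat.count_nth_of_infinite hA N]
  exact Nat.count_monotone A hn

lemma isShuffleClosed_energyParity {S : Type} {k : ℕ} (w : S → S → Fin k → ℤ) (p : S → ℕ) :
    IsShuffleClosed (energyParity w p) where
  shift_mem_iff u N := by
    refine and_congr (forall_congr' fun j =>
      exists_lowerBound_shift_iff (fun i => w (u i).1 (u i).2 j) N)
      (exists_congr fun d => and_congr Iff.rfl (and_congr ?_ ?_))
    · conv_rhs => rw [← map_add_atTop_eq_nat N]
      exact Iff.rfl
    · conv_rhs => rw [← map_add_atTop_eq_nat N]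
      exact Iff.rfl
  mem_of_shuffle := by
    classical
    rintro u A hA hA' ⟨hB₁, d₁, hd₁, hf₁, he₁⟩ ⟨hB₂, d₂, hd₂, hf₂, he₂⟩
    refine ⟨fun j => ?_, min d₁ d₂, ?_, ?_, ?_⟩
    · obtain ⟨B₁, hB₁⟩ := hB₁ j
      obtain ⟨B₂, hB₂⟩ := hB₂ j
      refine ⟨B₁ + B₂, fun n => ?_⟩
      rw [sum_range_eq_sum_nth_add_sum_nth_not (fun i => w (u i).1 (u i).2 j) A n]
      exact add_le_add (hB₁ _) (hB₂ _)
    · exact min_rec' Even hd₁ hd₂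
    · rcases min_choice d₁ d₂ with h | h <;> rw [h]
      · exact (Nat.nth_strictMono hA).tendsto_atTop.frequently hf₁
      · exact (Nat.nth_strictMono hA').tendsto_atTop.frequently hf₂
    · filter_upwards [eventually_of_eventually_nth (P := fun n => d₁ ≤ p (u n).1) hA he₁,
        eventually_of_eventually_nth (P := fun n => d₂ ≤ p (u n).1) hA' he₂] with n h₁ h₂
      by_cases h : A n
      · exact min_le_of_left_le (h₁ h)
      · exact min_le_of_right_le (h₂ h)

lemma infOft_iff_frequently {S : Type} {π : ℕ → S} {s : S} :
    InfOft π s ↔ ∃ᶠ n in atTop, π n = s :=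
  frequently_atTop.symm

lemma eventually_infOft {S : Type} [Finite S] (π : ℕ → S) : ∀ᶠ n in atTop, InfOft π (π n) := by
  have h : ∀ s, ∀ᶠ n in atTop, π n = s → InfOft π s := fun s => by
    by_cases hs : InfOft π s
    · exact Eventually.of_forall fun _ _ => hs
    · rw [infOft_iff_frequently, not_frequently] at hs
      exact hs.mono fun n hn h => absurd h hn
  filter_upwards [eventually_all.2 h] with n hn using hn _ rfl

lemma parityWin_iff {S : Type} [Finite S] (p : S → ℕ) (π : ℕ → S) :
    ParityWin p π ↔
      ∃ d, Even d ∧ (∃ᶠ n in atTop, p (π n) = d) ∧ ∀ᶠ n in atTop, d ≤ p (π n) := by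
  constructor
  · intro h
    refine ⟨_, h, ?_, ?_⟩
    · obtain ⟨n, hn⟩ := (eventually_infOft π).exists
      obtain ⟨s, hs, hps⟩ := Nat.sInf_mem (⟨_, _, hn, rfl⟩ : (p '' {s | InfOft π s}).Nonempty)
      exact (infOft_iff_frequently.1 hs).mono fun m hm => by rw [hm, hps]
    · exact (eventually_infOft π).mono fun n hn => Nat.sInf_le ⟨_, hn, rfl⟩
  · rintro ⟨d, hd, hf, he⟩
    have hmem : d ∈ p '' {s | InfOft π s} := by
      obtain ⟨n, hn, hInf⟩ := (hf.and_eventually (eventually_infOft π)).exists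
      exact ⟨_, hInf, hn⟩
    have hle : d ≤ sInf (p '' {s | InfOft π s}) := by
      refine le_csInf ⟨d, hmem⟩ ?_
      rintro _ ⟨s, hs, rfl⟩
      obtain ⟨n, hn, hdn⟩ := ((infOft_iff_frequently.1 hs).and_eventually he).exists
      rwa [← hn]
    rw [ParityWin, le_antisymm (Nat.sInf_le hmem) hle]
    exact hd

lemma edgeSeq_mem_energyParity_iff {S : Type} [Finite S] {k : ℕ} (w : S → S → Fin k → ℤ)
    (p : S → ℕ) (π : ℕ → S) :
    edgeSeq π ∈ energyParity w p ↔ ∃ v0, PosEnergy w v0 π ∧ ParityWin p π := by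
  rw [exists_and_right, parityWin_iff]
  refine and_congr ⟨fun h => ?_, fun ⟨v0, h⟩ j => ⟨-v0 j, fun n => ?_⟩⟩ Iff.rfl
  · choose B hB using h
    refine ⟨fun j => (-B j).toNat, fun n j => ?_⟩
    have h₁ : B j ≤ EL w π n j := hB j n
    have h₂ := Int.self_le_toNat (-B j)
    linarith
  · exact neg_le_iff_add_nonneg'.2 (h n j)

/-- Every play is consistent with some strategy of player 1. -/
lemma exists_consistent1 {S : Type} (isP1 : S → Prop) {E : S → S → Prop}
    (hE : ∀ s, ∃ t, E s t) {s0 : S} {π : ℕ → S} (hπ : IsPlayFrom E s0 π) :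
    ∃ σ, IsStrat1 isP1 E σ ∧ Consistent1 isP1 σ π := by
  classical
  choose f hf using hE
  refine ⟨fun h s => if E s (π (h.length + 1)) then π (h.length + 1) else f s, fun h s _ => ?_,
    fun n _ => ?_⟩
  · dsimp only
    split_ifs with hs
    exacts [hs, hf s]
  · simp [Hist, hπ.2 n]

/-- A strategy graph for player 1 yields a winning play against any strategy of player 2. -/
lemma P1Wins.exists_play {S : Type} {isP1 : S → Prop} {E : S → S → Prop}
    {W : Set (ℕ → S × S)} {t : S} (h : P1Wins isP1 E W t) {σ : List S → S → S}
    (hσ : IsStrat2 isP1 E σ) : ∃ π, IsPlayFrom E t π ∧ Consistent2 isP1 σ π ∧ edgeSeq π ∈ W := by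
  obtain ⟨X, q₀, rfl⟩ := h
  have hnext : ∀ (l : List S) (q : X.Node),
      ∃ q', X.Step q q' ∧ (¬ isP1 (X.pos q) → X.pos q' = σ l (X.pos q)) := fun l q => by
    by_cases hq : isP1 (X.pos q)
    · exact (X.exists_step q hq).imp fun q' hq' => ⟨hq', fun h => absurd hq h⟩
    · exact (X.follow q hq _ (hσ l _ hq)).imp fun q' hq' => ⟨hq'.1, fun _ => hq'.2⟩
  choose next hstep hcons using hnext
  let run : ℕ → List S × X.Node :=
    fun n => n.rec ([], q₀) fun _ c => (c.1 ++ [X.pos c.2], next c.1 c.2)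
  have hist : ∀ n, (run n).1 = Hist (fun n => X.pos (run n).2) n := fun n => by
    induction n with
    | zero => rfl
    | succ n ih =>
      change (run n).1 ++ [X.pos (run n).2] = _
      rw [ih]
      simp [Hist, List.range_succ]
  refine ⟨fun n => X.pos (run n).2, ⟨rfl, fun i => X.edge_of_step _ _ (hstep _ _)⟩,
    fun n hn => ?_, X.path_mem (fun n => (run n).2) fun n => hstep _ _⟩
  rw [← hist n]
  exact hcons _ _ hn

/-- if player 2 has a pure spoiling strategy in a multi energy parity game,
then he has a pure memoryless spoiling strategy. -/
theorem memoryless_spoiling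
    {S : Type} [Fintype S] (isP1 : S → Prop) (sinit : S)
    (E : S → S → Prop) (hE : ∀ s, ∃ t, E s t)
    (k : ℕ) (w : S → S → Fin k → ℤ) (p : S → ℕ)
    (hspoil : ∃ σ2 : List S → S → S, IsStrat2 isP1 E σ2 ∧
      ∀ (v0 : Fin k → ℕ) (σ1 : List S → S → S), IsStrat1 isP1 E σ1 →
        ∀ π : ℕ → S, IsPlayFrom E sinit π → Consistent1 isP1 σ1 π →
          Consistent2 isP1 σ2 π → ¬ (PosEnergy w v0 π ∧ ParityWin p π)) :
    ∃ f : S → S, (∀ s, ¬ isP1 s → E s (f s)) ∧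
      ∀ (v0 : Fin k → ℕ) (σ1 : List S → S → S), IsStrat1 isP1 E σ1 →
        ∀ π : ℕ → S, IsPlayFrom E sinit π → Consistent1 isP1 σ1 π →
          Consistent2 isP1 (fun _ s => f s) π →
          ¬ (PosEnergy w v0 π ∧ ParityWin p π) := by
  obtain ⟨σ2, hσ2, hspoil⟩ := hspoil
  rcases p1Wins_or_p2WinsMemoryless (isP1 := isP1) (isShuffleClosed_energyParity w p) E hE sinit
    with h | ⟨f, hf, hwin⟩
  · obtain ⟨π, hπ, hcons, hmem⟩ := h.exists_play hσ2
    obtain ⟨v0, hv0⟩ := (edgeSeq_mem_energyParity_iff w p π).1 hmem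
    obtain ⟨σ1, hσ1, hcons1⟩ := exists_consistent1 isP1 hE hπ
    exact absurd hv0 (hspoil v0 σ1 hσ1 π hπ hcons1 hcons)
  · exact ⟨f, hf, fun v0 σ1 _ π hπ _ hcons hv0 =>
      hwin π hπ hcons ((edgeSeq_mem_energyParity_iff w p π).2 ⟨v0, hv0⟩)⟩

end Stmt1
end

section
/- For every K ≥ 1, in the multi energy game G(K) of dimension k = 2K with weights in {−1,0,1} described in the context, player P₁ has a pure finite-memory winning strategy for the initial credit (1,…,1) ∈ ℕ^{2K}: namely, the strategy that, at each state t_i, plays towards t_{i,L} if P₂'s last choice at s_i was s_{i,R} and towards t_{i,R} if it was s_{i,L}; this strategy is encoded by a Moore machine with 2^K memory states and every consistent play π satisfies (1,…,1) + EL(π(n)) ≥ 0 componentwise for all n. -/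
namespace Stmt6

def IsPlayFrom {S : Type} (E : S → S → Prop) (s0 : S) (π : ℕ → S) : Prop :=
  π 0 = s0 ∧ ∀ i, E (π i) (π (i + 1))

def EL {S : Type} {k : ℕ} (w : S → S → Fin k → ℤ) (π : ℕ → S) (n : ℕ) (j : Fin k) : ℤ :=
  ∑ i ∈ Finset.range n, w (π i) (π (i + 1)) j

def PosEnergy {S : Type} {k : ℕ} (w : S → S → Fin k → ℤ) (v0 : Fin k → ℕ) (π : ℕ → S) :
    Prop :=
  ∀ n j, 0 ≤ (v0 j : ℤ) + EL w π n j

def IsStrat1 {S : Type} (isP1 : S → Prop) (E : S → S → Prop) (σ : List S → S → S) : Prop :=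
  ∀ h s, isP1 s → E s (σ h s)

def Hist {S : Type} (π : ℕ → S) (n : ℕ) : List S := (List.range n).map π

def Consistent1 {S : Type} (isP1 : S → Prop) (σ : List S → S → S) (π : ℕ → S) : Prop :=
  ∀ n, isP1 (π n) → π (n + 1) = σ (Hist π n) (π n)

def MooreStrat {S M : Type} (m0 : M) (αu : M → S → M) (αn : M → S → S) :
    List S → S → S :=
  fun h s => αn (h.foldl αu m0) s

/-- The states of the game `G(K)`. -/
inductive GKState (K : ℕ) : Type where
  | s (i : Fin K) | sL (i : Fin K) | sR (i : Fin K)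
  | t (i : Fin K) | tL (i : Fin K) | tR (i : Fin K)
  deriving DecidableEq

/-- States `t_i, t_{i,L}, t_{i,R}` belong to player 1. -/
def gkIsP1 {K : ℕ} : GKState K → Prop
  | .t _ => True
  | .tL _ => True
  | .tR _ => True
  | _ => False

/-- The edges of `G(K)`. -/
def gkEdge {K : ℕ} : GKState K → GKState K → Prop
  | .s i, .sL j => i = j
  | .s i, .sR j => i = j
  | .sL i, .s j => (i : ℕ) + 1 = (j : ℕ)
  | .sL i, .t j => (i : ℕ) + 1 = K ∧ (j : ℕ) = 0
  | .sR i, .s j => (i : ℕ) + 1 = (j : ℕ)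
  | .sR i, .t j => (i : ℕ) + 1 = K ∧ (j : ℕ) = 0
  | .t i, .tL j => i = j
  | .t i, .tR j => i = j
  | .tL i, .t j => (i : ℕ) + 1 = (j : ℕ)
  | .tL i, .s j => (i : ℕ) + 1 = K ∧ (j : ℕ) = 0
  | .tR i, .t j => (i : ℕ) + 1 = (j : ℕ)
  | .tR i, .s j => (i : ℕ) + 1 = K ∧ (j : ℕ) = 0
  | _, _ => False

/-- The weight function of `G(K)` (values in `{-1,0,1}`), with dimensions `2i−1, 2i`
(1-indexed) stored at indices `2i, 2i+1` (0-indexed, `i : Fin K`). -/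
def gkW {K : ℕ} : GKState K → GKState K → Fin (2 * K) → ℤ
  | .s i, .sL _, j =>
      if (j : ℕ) = 2 * (i : ℕ) then 1 else if (j : ℕ) = 2 * (i : ℕ) + 1 then -1 else 0
  | .s i, .sR _, j =>
      if (j : ℕ) = 2 * (i : ℕ) then -1 else if (j : ℕ) = 2 * (i : ℕ) + 1 then 1 else 0
  | .t i, .tL _, j =>
      if (j : ℕ) = 2 * (i : ℕ) then 1 else if (j : ℕ) = 2 * (i : ℕ) + 1 then -1 else 0
  | .t i, .tR _, j =>
      if (j : ℕ) = 2 * (i : ℕ) then -1 else if (j : ℕ) = 2 * (i : ℕ) + 1 then 1 else 0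
  | _, _, _ => 0

/-- Memory update of the Moore machine: remember, for each gadget `i`, player 2's last
choice at `s_i` (`true` iff it was `s_{i,L}`). -/
def gkUpd {K : ℕ} : (Fin K → Bool) → GKState K → (Fin K → Bool) :=
  fun mem st => match st with
    | .sL i => Function.update mem i true
    | .sR i => Function.update mem i false
    | _ => mem

/-- Next-action function: at `t_i`, play the opposite of player 2's last choice at
`s_i`; at `t_{i,L}` and `t_{i,R}` follow the unique outgoing edge. -/
def gkNext {K : ℕ} (hK : 0 < K) : (Fin K → Bool) → GKState K → GKState K :=
  fun mem st => match st with
    | .t i => if mem i then .tR i else .tL i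
    | .tL i => if h : (i : ℕ) + 1 < K then .t ⟨(i : ℕ) + 1, h⟩ else .s ⟨0, hK⟩
    | .tR i => if h : (i : ℕ) + 1 < K then .t ⟨(i : ℕ) + 1, h⟩ else .s ⟨0, hK⟩
    | st' => st'

/-- The energy of gadget `i` (in its first dimension) as a function of the memory and the
current state, along plays consistent with the copy-the-opposite strategy. -/
def gkBalance {K : ℕ} (mem : Fin K → Bool) (i : Fin K) : GKState K → ℤ
  | .s j => if i < j then (if mem i then 1 else -1) else 0
  | .sL j => if i < j then (if mem i then 1 else -1) else if i = j then 1 else 0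
  | .sR j => if i < j then (if mem i then 1 else -1) else if i = j then -1 else 0
  | .t j => if i < j then 0 else (if mem i then 1 else -1)
  | .tL j => if i ≤ j then 0 else (if mem i then 1 else -1)
  | .tR j => if i ≤ j then 0 else (if mem i then 1 else -1)

theorem abs_gkBalance_le_one {K : ℕ} (mem : Fin K → Bool) (i : Fin K) (st : GKState K) :
    |gkBalance mem i st| ≤ 1 := by
  cases st <;> simp only [gkBalance] <;> split_ifs <;> simp

/-- The weight of an edge in dimension `j`, in terms of gadget `j / 2`. -/
theorem gkBalance_step {K : ℕ} (hK : 0 < K) (mem : Fin K → Bool) {st st' : GKState K}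
    (hE : gkEdge st st') (hσ : gkIsP1 st → st' = gkNext hK mem st)
    (j : Fin (2 * K)) (i : Fin K) (hi : (i : ℕ) = (j : ℕ) / 2) :
    gkW st st' j = (if (j : ℕ) % 2 = 0 then 1 else -1) *
      (gkBalance (gkUpd mem st) i st' - gkBalance mem i st) := by
  have hi_lt := i.isLt
  cases st <;> cases st' <;> simp only [gkEdge] at hE <;>
    simp only [gkIsP1, gkNext, forall_const] at hσ <;>
    simp only [gkW, gkBalance, gkUpd, Function.update_apply, Fin.lt_def, Fin.le_def,
      Fin.ext_iff] at * <;>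
    grind

theorem EL_eq_gkBalance {K : ℕ} (hK : 0 < K) {π : ℕ → GKState K}
    (hπ : IsPlayFrom gkEdge (.s ⟨0, hK⟩) π)
    (hσ : Consistent1 gkIsP1 (MooreStrat (fun _ => false) gkUpd (gkNext hK)) π)
    (j : Fin (2 * K)) (i : Fin K) (hi : (i : ℕ) = (j : ℕ) / 2) (n : ℕ) :
    EL gkW π n j = (if (j : ℕ) % 2 = 0 then 1 else -1) *
      gkBalance ((Hist π n).foldl gkUpd fun _ => false) i (π n) := by
  induction n with
  | zero => simp [EL, hπ.1, gkBalance, Fin.lt_def]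
  | succ n ih =>
    have hstep := gkBalance_step hK _ (hπ.2 n) (hσ n) j i hi
    have hEL : EL gkW π (n + 1) j = EL gkW π n j + gkW (π n) (π (n + 1)) j :=
      Finset.sum_range_succ _ _
    have hHist : Hist π (n + 1) = Hist π n ++ [π n] := by simp [Hist, List.range_succ]
    rw [hEL, ih, hstep, hHist, List.foldl_append, List.foldl_cons, List.foldl_nil]
    ring

theorem isStrat1_gk {K : ℕ} (hK : 0 < K) :
    IsStrat1 gkIsP1 gkEdge (MooreStrat (fun _ => false) gkUpd (gkNext hK)) := by
  intro h st hst
  cases st with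
  | s i | sL i | sR i => exact hst.elim
  | t i => simp only [MooreStrat, gkNext]; split_ifs <;> simp [gkEdge]
  | tL i | tR i =>
    have := i.isLt
    simp only [MooreStrat, gkNext]
    split_ifs <;> (simp [gkEdge]; try omega)

/-- in `G(K)` the copy-the-opposite strategy, encoded by a Moore machine
with `2^K` memory states, is a legal strategy of player 1 and wins for the initial
credit `(1,…,1)`. -/
theorem gk_winning_strategy (K : ℕ) (hK : 0 < K) :
    IsStrat1 gkIsP1 gkEdge (MooreStrat (fun _ => false) gkUpd (gkNext hK)) ∧
    Fintype.card (Fin K → Bool) = 2 ^ K ∧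
    ∀ π : ℕ → GKState K, IsPlayFrom gkEdge (.s ⟨0, hK⟩) π →
      Consistent1 gkIsP1 (MooreStrat (fun _ => false) gkUpd (gkNext hK)) π →
      PosEnergy gkW (fun _ => 1) π := by
  refine ⟨isStrat1_gk hK, by simp, fun π hπ hσ n j => ?_⟩
  have hj : (j : ℕ) / 2 < K := by omega
  rw [EL_eq_gkBalance hK hπ hσ j ⟨_, hj⟩ rfl n]
  have hb := abs_le.mp (abs_gkBalance_le_one
    ((Hist π n).foldl gkUpd fun _ => false) ⟨_, hj⟩ (π n))
  push_cast
  split_ifs <;> linarith [hb.1, hb.2]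

end Stmt6
end

section
/- For every K ≥ 1 and every initial credit v₀ ∈ ℕ^{2K}, every pure finite-memory strategy of P₁ in the multi energy game G(K) that is encoded by a deterministic Moore machine with fewer than 2^K memory states fails to be winning: there exists a pure strategy of P₂ such that the resulting outcome π has v₀ + EL(π(n)) < 0 in some dimension for some n. Hence exponential memory (at least 2^K = 2^{k/2} memory states) is necessary to win G(K), for any initial credit. -/
namespace Stmt7

def IsPlayFrom {S : Type} (E : S → S → Prop) (s0 : S) (π : ℕ → S) : Prop :=
  π 0 = s0 ∧ ∀ i, E (π i) (π (i + 1))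

def EL {S : Type} {k : ℕ} (w : S → S → Fin k → ℤ) (π : ℕ → S) (n : ℕ) (j : Fin k) : ℤ :=
  ∑ i ∈ Finset.range n, w (π i) (π (i + 1)) j

def IsStrat1 {S : Type} (isP1 : S → Prop) (E : S → S → Prop) (σ : List S → S → S) : Prop :=
  ∀ h s, isP1 s → E s (σ h s)

def IsStrat2 {S : Type} (isP1 : S → Prop) (E : S → S → Prop) (σ : List S → S → S) : Prop :=
  ∀ h s, ¬ isP1 s → E s (σ h s)

def Hist {S : Type} (π : ℕ → S) (n : ℕ) : List S := (List.range n).map π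

def Consistent1 {S : Type} (isP1 : S → Prop) (σ : List S → S → S) (π : ℕ → S) : Prop :=
  ∀ n, isP1 (π n) → π (n + 1) = σ (Hist π n) (π n)

def Consistent2 {S : Type} (isP1 : S → Prop) (σ : List S → S → S) (π : ℕ → S) : Prop :=
  ∀ n, ¬ isP1 (π n) → π (n + 1) = σ (Hist π n) (π n)

def MooreStrat {S M : Type} (m0 : M) (αu : M → S → M) (αn : M → S → S) :
    List S → S → S :=
  fun h s => αn (h.foldl αu m0) s

inductive GKState (K : ℕ) : Type where
  | s (i : Fin K) | sL (i : Fin K) | sR (i : Fin K)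
  | t (i : Fin K) | tL (i : Fin K) | tR (i : Fin K)
  deriving DecidableEq

def gkIsP1 {K : ℕ} : GKState K → Prop
  | .t _ => True
  | .tL _ => True
  | .tR _ => True
  | _ => False

def gkEdge {K : ℕ} : GKState K → GKState K → Prop
  | .s i, .sL j => i = j
  | .s i, .sR j => i = j
  | .sL i, .s j => (i : ℕ) + 1 = (j : ℕ)
  | .sL i, .t j => (i : ℕ) + 1 = K ∧ (j : ℕ) = 0
  | .sR i, .s j => (i : ℕ) + 1 = (j : ℕ)
  | .sR i, .t j => (i : ℕ) + 1 = K ∧ (j : ℕ) = 0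
  | .t i, .tL j => i = j
  | .t i, .tR j => i = j
  | .tL i, .t j => (i : ℕ) + 1 = (j : ℕ)
  | .tL i, .s j => (i : ℕ) + 1 = K ∧ (j : ℕ) = 0
  | .tR i, .t j => (i : ℕ) + 1 = (j : ℕ)
  | .tR i, .s j => (i : ℕ) + 1 = K ∧ (j : ℕ) = 0
  | _, _ => False

def gkW {K : ℕ} : GKState K → GKState K → Fin (2 * K) → ℤ
  | .s i, .sL _, j =>
      if (j : ℕ) = 2 * (i : ℕ) then 1 else if (j : ℕ) = 2 * (i : ℕ) + 1 then -1 else 0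
  | .s i, .sR _, j =>
      if (j : ℕ) = 2 * (i : ℕ) then -1 else if (j : ℕ) = 2 * (i : ℕ) + 1 then 1 else 0
  | .t i, .tL _, j =>
      if (j : ℕ) = 2 * (i : ℕ) then 1 else if (j : ℕ) = 2 * (i : ℕ) + 1 then -1 else 0
  | .t i, .tR _, j =>
      if (j : ℕ) = 2 * (i : ℕ) then -1 else if (j : ℕ) = 2 * (i : ℕ) + 1 then 1 else 0
  | _, _, _ => 0

section BitStreams

variable {M : Type} (K : ℕ) (m0 : M) (nxt : ℕ → M → Bool → M) (out : ℕ → M → Bool)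

/-- The sign contributed by a left (`true`) or right (`false`) move. -/
def bitSign (b : Bool) : ℤ := if b then 1 else -1

/-- The bit played in macro step `q`: taken from the stream `x` in even phases of length `K`, and
computed from the memory in odd phases. -/
def phaseBit (x : ℕ → Bool) (q : ℕ) (m : M) : Bool :=
  if (q / K) % 2 = 0 then x q else out q m

/-- The memory before macro step `q`. -/
def phaseMem (x : ℕ → Bool) : ℕ → M
  | 0 => m0
  | q + 1 => nxt q (phaseMem x q) (phaseBit K out x q (phaseMem x q))

/-- The sum of the signs played before macro step `q`, position `i` of a phase being
weighted by `2 ^ i`. -/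
def phaseSum (x : ℕ → Bool) (q : ℕ) : ℤ :=
  ∑ p ∈ Finset.range q,
    2 ^ (p % K) * bitSign (phaseBit K out x p (phaseMem K m0 nxt out x p))

/-- The stream following `x` before time `N` and then repeating the binary digits of `y`. -/
def spliceBits (x : ℕ → Bool) (N y : ℕ) : ℕ → Bool :=
  fun q => if q < N then x q else y.testBit (q % K)

theorem phase_congr (x x' : ℕ → Bool) (a n : ℕ)
    (hm : phaseMem K m0 nxt out x a = phaseMem K m0 nxt out x' a)
    (hx : ∀ i < n, ((a + i) / K) % 2 = 0 → x (a + i) = x' (a + i)) :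
    phaseMem K m0 nxt out x (a + n) = phaseMem K m0 nxt out x' (a + n) ∧
    phaseSum K m0 nxt out x (a + n) - phaseSum K m0 nxt out x a =
      phaseSum K m0 nxt out x' (a + n) - phaseSum K m0 nxt out x' a := by
  induction n with
  | zero => exact ⟨hm, by simp⟩
  | succ n ih =>
    obtain ⟨h1, h2⟩ := ih fun i hi => hx i (by omega)
    have hb : phaseBit K out x (a + n) (phaseMem K m0 nxt out x (a + n)) =
        phaseBit K out x' (a + n) (phaseMem K m0 nxt out x' (a + n)) := by
      unfold phaseBit
      split_ifs with h
      · exact hx n (by omega) h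
      · rw [h1]
    constructor
    · rw [← add_assoc, phaseMem, phaseMem, hb, h1]
    · rw [← add_assoc]
      unfold phaseSum at h2 ⊢
      rw [Finset.sum_range_succ, Finset.sum_range_succ _ (a + n), hb]
      linarith

theorem splice_before (x : ℕ → Bool) (N y : ℕ) :
    phaseMem K m0 nxt out (spliceBits K x N y) N = phaseMem K m0 nxt out x N ∧
    phaseSum K m0 nxt out (spliceBits K x N y) N = phaseSum K m0 nxt out x N := by
  have h := phase_congr K m0 nxt out (spliceBits K x N y) x 0 N rfl
    (fun i hi _ => by simp [spliceBits, hi])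
  simpa [phaseSum] using h

theorem phaseSum_splice (x : ℕ → Bool) (r y i : ℕ) (hi : i ≤ K) :
    phaseSum K m0 nxt out (spliceBits K x (2 * K * r) y) (2 * K * r + i) =
      phaseSum K m0 nxt out x (2 * K * r) + 2 * ((y % 2 ^ i : ℕ) : ℤ) - (2 ^ i - 1) := by
  induction i with
  | zero => simp [splice_before, Nat.mod_one]
  | succ i ih =>
    have h1 : (2 * K * r + i) % K = i := by
      rw [mul_comm 2 K, mul_assoc, Nat.mul_add_mod, Nat.mod_eq_of_lt (by omega)]
    have h2 : (2 * K * r + i) / K % 2 = 0 := by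
      rw [mul_comm 2 K, mul_assoc, Nat.mul_add_div (by omega), Nat.div_eq_of_lt (by omega)]
      omega
    have hs : phaseSum K m0 nxt out (spliceBits K x (2 * K * r) y) (2 * K * r + i + 1) =
        phaseSum K m0 nxt out (spliceBits K x (2 * K * r) y) (2 * K * r + i) +
          2 ^ i * bitSign (y.testBit i) := by
      unfold phaseSum
      rw [Finset.sum_range_succ, phaseBit, if_pos h2, h1]
      simp [spliceBits, h1]
    have hy : y % 2 ^ (i + 1) = y % 2 ^ i + 2 ^ i * (y.testBit i).toNat := by
      rw [Nat.mod_pow_succ, Nat.toNat_testBit]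
    rw [← add_assoc, hs, ih (by omega), hy]
    cases y.testBit i <;> simp [bitSign] <;> ring

/-- With fewer than `2 ^ K` memory states, two streams can reach the same memory with
weighted sums arbitrarily far apart. -/
theorem exists_phaseSum_gap [Fintype M] (hK : 0 < K) (hM : Fintype.card M < 2 ^ K) (r : ℕ) :
    ∃ x x' : ℕ → Bool,
      phaseMem K m0 nxt out x (2 * K * r) = phaseMem K m0 nxt out x' (2 * K * r) ∧
      (r : ℤ) ≤ phaseSum K m0 nxt out x' (2 * K * r) - phaseSum K m0 nxt out x (2 * K * r) := by
  induction r with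
  | zero => exact ⟨fun _ => true, fun _ => true, rfl, by simp⟩
  | succ r ih =>
    obtain ⟨x, x', hm, hF⟩ := ih
    set N := 2 * K * r with hN
    obtain ⟨y, y', hlt, hy⟩ : ∃ y y' : Fin (2 ^ K), y < y' ∧
        phaseMem K m0 nxt out (spliceBits K x N y) (N + K) =
          phaseMem K m0 nxt out (spliceBits K x N y') (N + K) := by
      obtain ⟨y, y', hne, h⟩ := Fintype.exists_ne_map_eq_of_card_lt
        (fun y : Fin (2 ^ K) => phaseMem K m0 nxt out (spliceBits K x N y) (N + K))
        (by simpa using hM)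
      rcases lt_or_gt_of_ne hne with h' | h'
      · exact ⟨y, y', h', h⟩
      · exact ⟨y', y, h', h.symm⟩
    have hswap := (phase_congr K m0 nxt out (spliceBits K x N y') (spliceBits K x' N y') N K
      (by rw [(splice_before K m0 nxt out x N y').1, (splice_before K m0 nxt out x' N y').1, hm])
      (fun i _ _ => by simp [spliceBits])).1
    have hodd : ∀ i < K, (N + K + i) / K % 2 = 1 := by
      intro i hi
      have : N + K + i = K * (2 * r + 1) + i := by rw [hN]; ring
      rw [this, Nat.mul_add_div hK, Nat.div_eq_of_lt hi]
      omega
    obtain ⟨h1, h2⟩ := phase_congr K m0 nxt out (spliceBits K x N y) (spliceBits K x' N y')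
      (N + K) K (hy.trans hswap) (fun i hi h => by have := hodd i hi; omega)
    have hend : 2 * K * (r + 1) = N + K + K := by rw [hN]; ring
    refine ⟨spliceBits K x N y, spliceBits K x' N y', ?_, ?_⟩
    · rw [hend, h1]
    · have e1 := phaseSum_splice K m0 nxt out x r y K le_rfl
      have e2 := phaseSum_splice K m0 nxt out x' r y' K le_rfl
      rw [Nat.mod_eq_of_lt y.2] at e1
      rw [Nat.mod_eq_of_lt y'.2] at e2
      have : ((y : ℕ) : ℤ) < ((y' : ℕ) : ℤ) := by exact_mod_cast hlt
      rw [hend]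
      push_cast
      linarith

theorem exists_phaseSum_large [Fintype M] (hK : 0 < K) (hM : Fintype.card M < 2 ^ K) (C : ℕ) :
    ∃ (x : ℕ → Bool) (q : ℕ), (C : ℤ) < |phaseSum K m0 nxt out x q| := by
  obtain ⟨x, x', -, h⟩ := exists_phaseSum_gap K m0 nxt out hK hM (2 * C + 1)
  by_contra! hc
  have h1 := abs_le.1 (hc x (2 * K * (2 * C + 1)))
  have h2 := abs_le.1 (hc x' (2 * K * (2 * C + 1)))
  push_cast at h
  linarith [h1.1, h2.2]

end BitStreams

section Play

variable {K : ℕ}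

/-- The branching state visited in macro step `q`. -/
def gkMain (hK : 0 < K) (q : ℕ) : GKState K :=
  if (q / K) % 2 = 0 then .s ⟨q % K, Nat.mod_lt _ hK⟩ else .t ⟨q % K, Nat.mod_lt _ hK⟩

/-- The intermediate state visited in macro step `q` when the bit `b` is played. -/
def gkHalf (hK : 0 < K) (q : ℕ) (b : Bool) : GKState K :=
  if (q / K) % 2 = 0 then
    if b then .sL ⟨q % K, Nat.mod_lt _ hK⟩ else .sR ⟨q % K, Nat.mod_lt _ hK⟩
  else
    if b then .tL ⟨q % K, Nat.mod_lt _ hK⟩ else .tR ⟨q % K, Nat.mod_lt _ hK⟩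

/-- The play in which the bit `b q` is played in macro step `q`. -/
def gkPlay (hK : 0 < K) (b : ℕ → Bool) (n : ℕ) : GKState K :=
  if n % 2 = 0 then gkMain hK (n / 2) else gkHalf hK (n / 2) (b (n / 2))

theorem gkPlay_even (hK : 0 < K) (b : ℕ → Bool) (q : ℕ) :
    gkPlay hK b (2 * q) = gkMain hK q := by
  simp [gkPlay]

theorem gkPlay_odd (hK : 0 < K) (b : ℕ → Bool) (q : ℕ) :
    gkPlay hK b (2 * q + 1) = gkHalf hK q (b q) := by
  have h1 : (2 * q + 1) % 2 = 1 := by omega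
  have h2 : (2 * q + 1) / 2 = q := by omega
  simp [gkPlay, h1, h2]

theorem gkEdge_main_half (hK : 0 < K) (q : ℕ) (b : Bool) :
    gkEdge (gkMain hK q) (gkHalf hK q b) := by
  unfold gkMain gkHalf
  split_ifs <;> simp [gkEdge]

theorem succ_div_mod_cases (hK : 0 < K) (q : ℕ) :
    (q % K + 1 < K ∧ (q + 1) % K = q % K + 1 ∧ (q + 1) / K = q / K) ∨
    (q % K + 1 = K ∧ (q + 1) % K = 0 ∧ (q + 1) / K = q / K + 1) := by
  have hlt := Nat.mod_lt q hK
  have hq := Nat.div_add_mod q K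
  rcases Nat.lt_or_ge (q % K + 1) K with h | h
  · left
    have e : q + 1 = K * (q / K) + (q % K + 1) := by omega
    refine ⟨h, ?_, ?_⟩
    · rw [e, Nat.mul_add_mod, Nat.mod_eq_of_lt h]
    · conv_lhs => rw [e]
      rw [Nat.mul_add_div hK, Nat.div_eq_of_lt h, add_zero]
  · right
    have e : q + 1 = K * (q / K + 1) := by rw [mul_add]; omega
    refine ⟨by omega, ?_, ?_⟩
    · rw [e, Nat.mul_mod_right]
    · conv_lhs => rw [e]
      rw [Nat.mul_div_cancel_left _ hK]

theorem gkEdge_half_iff (hK : 0 < K) (q : ℕ) (b : Bool) (s : GKState K) :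
    gkEdge (gkHalf hK q b) s ↔ s = gkMain hK (q + 1) := by
  have hmod := succ_div_mod_cases hK q
  unfold gkMain gkHalf
  rcases hmod with ⟨h1, h2, h3⟩ | ⟨h1, h2, h3⟩
  · simp only [h2, h3]
    split_ifs <;> cases s <;> simp [gkEdge, Fin.ext_iff] <;> omega
  · simp only [h2, h3]
    split_ifs <;> first | omega | (cases s <;> simp [gkEdge, Fin.ext_iff] <;> omega)

theorem gkEdge_main_of_isP1 (hK : 0 < K) (q : ℕ) (s : GKState K)
    (h : gkEdge (gkMain hK q) s) : s = gkHalf hK q (decide (s = gkHalf hK q true)) := by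
  unfold gkMain at h
  unfold gkHalf
  split_ifs at h ⊢ <;> cases s <;> simp_all [gkEdge]

theorem gkIsP1_main (hK : 0 < K) (q : ℕ) :
    gkIsP1 (gkMain hK q) ↔ (q / K) % 2 ≠ 0 := by
  unfold gkMain
  split_ifs with h <;> simp [gkIsP1, h]

theorem gkPlay_isPlayFrom (hK : 0 < K) (b : ℕ → Bool) :
    IsPlayFrom gkEdge (.s ⟨0, hK⟩) (gkPlay hK b) := by
  refine ⟨by simp [gkPlay, gkMain], fun n => ?_⟩
  obtain ⟨q, rfl | rfl⟩ := Nat.even_or_odd' n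
  · rw [gkPlay_even, gkPlay_odd]
    exact gkEdge_main_half hK q _
  · rw [gkPlay_odd, show 2 * q + 1 + 1 = 2 * (q + 1) by ring, gkPlay_even]
    exact (gkEdge_half_iff hK q _ _).2 rfl

theorem Hist_succ {S : Type} (π : ℕ → S) (n : ℕ) : Hist π (n + 1) = Hist π n ++ [π n] := by
  simp [Hist, List.range_succ]

theorem gkPlay_EL_step (hK : 0 < K) (b : ℕ → Bool) (q : ℕ) (j : Fin (2 * K)) :
    EL gkW (gkPlay hK b) (2 * (q + 1)) j =
      EL gkW (gkPlay hK b) (2 * q) j + gkW (gkMain hK q) (gkHalf hK q (b q)) j := by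
  have hz : gkW (gkHalf hK q (b q)) (gkMain hK (q + 1)) j = 0 := by
    unfold gkHalf
    split_ifs <;> rfl
  unfold EL
  rw [show 2 * (q + 1) = 2 * q + 1 + 1 by ring, Finset.sum_range_succ, Finset.sum_range_succ,
    show 2 * q + 1 + 1 = 2 * (q + 1) by ring, gkPlay_even, gkPlay_odd, gkPlay_even, hz, add_zero]

theorem gkW_main_half (hK : 0 < K) (q : ℕ) (b : Bool) (i : Fin K) :
    gkW (gkMain hK q) (gkHalf hK q b) ⟨2 * i, by omega⟩ =
        (if i = ⟨q % K, Nat.mod_lt _ hK⟩ then bitSign b else 0) ∧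
    gkW (gkMain hK q) (gkHalf hK q b) ⟨2 * i + 1, by omega⟩ =
        -(if i = ⟨q % K, Nat.mod_lt _ hK⟩ then bitSign b else 0) := by
  have h : ∀ a : ℕ, 2 * (i : ℕ) + 1 ≠ 2 * a := fun a => by omega
  have h' : ∀ a : ℕ, 2 * (i : ℕ) ≠ 2 * a + 1 := fun a => by omega
  unfold gkMain gkHalf
  split_ifs <;> simp_all [gkW, bitSign, Fin.ext_iff]

theorem gkPlay_EL_neg (hK : 0 < K) (b : ℕ → Bool) (q : ℕ) (i : Fin K) :
    EL gkW (gkPlay hK b) (2 * q) ⟨2 * i + 1, by omega⟩ =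
      -EL gkW (gkPlay hK b) (2 * q) ⟨2 * i, by omega⟩ := by
  induction q with
  | zero => simp [EL]
  | succ q ih =>
    rw [gkPlay_EL_step, gkPlay_EL_step, ih, (gkW_main_half hK q _ i).1,
      (gkW_main_half hK q _ i).2]
    ring

theorem gkPlay_weighted_EL (hK : 0 < K) (b : ℕ → Bool) (q : ℕ) :
    ∑ i : Fin K, 2 ^ (i : ℕ) * EL gkW (gkPlay hK b) (2 * q) ⟨2 * i, by omega⟩ =
      ∑ p ∈ Finset.range q, 2 ^ (p % K) * bitSign (b p) := by
  induction q with
  | zero => simp [EL]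
  | succ q ih =>
    rw [Finset.sum_range_succ, ← ih]
    simp_rw [gkPlay_EL_step, (gkW_main_half hK q _ _).1, mul_add]
    rw [Finset.sum_add_distrib]
    simp

theorem exists_gkEdge (hK : 0 < K) (s : GKState K) : ∃ s', gkEdge s s' := by
  have aux : ∀ i : Fin K, (i : ℕ) + 1 < K ∨ (i : ℕ) + 1 = K := fun i => by omega
  cases s with
  | s i => exact ⟨.sL i, rfl⟩
  | t i => exact ⟨.tL i, rfl⟩
  | sL i =>
    rcases aux i with h | h
    · exact ⟨.s ⟨i + 1, h⟩, rfl⟩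
    · exact ⟨.t ⟨0, hK⟩, h, rfl⟩
  | sR i =>
    rcases aux i with h | h
    · exact ⟨.s ⟨i + 1, h⟩, rfl⟩
    · exact ⟨.t ⟨0, hK⟩, h, rfl⟩
  | tL i =>
    rcases aux i with h | h
    · exact ⟨.t ⟨i + 1, h⟩, rfl⟩
    · exact ⟨.s ⟨0, hK⟩, h, rfl⟩
  | tR i =>
    rcases aux i with h | h
    · exact ⟨.t ⟨i + 1, h⟩, rfl⟩
    · exact ⟨.s ⟨0, hK⟩, h, rfl⟩

/-- In a graph without dead ends, every play is consistent with some strategy of player 2. -/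
theorem exists_strat2_of_play {S : Type} (isP1 : S → Prop) (E : S → S → Prop)
    (hE : ∀ s, ∃ s', E s s') (π : ℕ → S) (hπ : ∀ n, E (π n) (π (n + 1))) :
    ∃ σ, IsStrat2 isP1 E σ ∧ Consistent2 isP1 σ π := by
  classical
  choose f hf using hE
  refine ⟨fun h s => if E s (π (h.length + 1)) then π (h.length + 1) else f s, ?_, ?_⟩
  · intro h s _
    dsimp only
    split_ifs with hs
    · exact hs
    · exact hf s
  · intro n _
    simp [Hist, hπ n]

/-- The memory update of a Moore machine over one macro step. -/
def gkNext {M : Type} (hK : 0 < K) (αu : M → GKState K → M) (q : ℕ) (m : M) (b : Bool) : M :=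
  αu (αu m (gkMain hK q)) (gkHalf hK q b)

/-- The bit a Moore machine plays in macro step `q`. -/
def gkOut {M : Type} (hK : 0 < K) (αn : M → GKState K → GKState K) (q : ℕ) (m : M) : Bool :=
  decide (αn m (gkMain hK q) = gkHalf hK q true)

/-- The bits played when player 2 follows `x` against a Moore machine. -/
def gkBits {M : Type} (hK : 0 < K) (m0 : M) (αu : M → GKState K → M)
    (αn : M → GKState K → GKState K) (x : ℕ → Bool) (q : ℕ) : Bool :=
  phaseBit K (gkOut hK αn) x q (phaseMem K m0 (gkNext hK αu) (gkOut hK αn) x q)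

theorem gkPlay_foldl {M : Type} (hK : 0 < K) (m0 : M) (αu : M → GKState K → M)
    (αn : M → GKState K → GKState K) (x : ℕ → Bool) (q : ℕ) :
    (Hist (gkPlay hK (gkBits hK m0 αu αn x)) (2 * q)).foldl αu m0 =
      phaseMem K m0 (gkNext hK αu) (gkOut hK αn) x q := by
  induction q with
  | zero => rfl
  | succ q ih =>
    rw [show 2 * (q + 1) = 2 * q + 1 + 1 by ring, Hist_succ, Hist_succ, List.foldl_append,
      List.foldl_append, ih, gkPlay_even, gkPlay_odd]
    rfl

theorem gkPlay_consistent1 {M : Type} (hK : 0 < K) (m0 : M) (αu : M → GKState K → M)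
    (αn : M → GKState K → GKState K) (hleg : IsStrat1 gkIsP1 gkEdge (MooreStrat m0 αu αn))
    (x : ℕ → Bool) :
    Consistent1 gkIsP1 (MooreStrat m0 αu αn) (gkPlay hK (gkBits hK m0 αu αn x)) := by
  intro n hn
  have hedge := hleg (Hist (gkPlay hK (gkBits hK m0 αu αn x)) n) _ hn
  obtain ⟨q, rfl | rfl⟩ := Nat.even_or_odd' n
  · rw [gkPlay_even] at hn hedge ⊢
    rw [gkPlay_odd, gkEdge_main_of_isP1 hK q _ hedge, gkBits, phaseBit,
      if_neg ((gkIsP1_main hK q).1 hn), gkOut, MooreStrat, gkPlay_foldl]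
  · rw [gkPlay_odd] at hedge ⊢
    rw [show 2 * q + 1 + 1 = 2 * (q + 1) by ring, gkPlay_even]
    exact ((gkEdge_half_iff hK q _ _).1 hedge).symm

end Play

/-- in `G(K)`, for any initial credit, any strategy of player 1 encoded by
a Moore machine with fewer than `2^K` memory states is not winning: player 2 has a pure
strategy making the energy drop below zero in some dimension. -/
theorem gk_exponential_memory_necessary
    (K : ℕ) (hK : 0 < K) (v0 : Fin (2 * K) → ℕ)
    (M : Type) [iM : Fintype M] (hM : Fintype.card M < 2 ^ K)
    (m0 : M) (αu : M → GKState K → M) (αn : M → GKState K → GKState K)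
    (hleg : IsStrat1 gkIsP1 gkEdge (MooreStrat m0 αu αn)) :
    ∃ σ2 : List (GKState K) → GKState K → GKState K,
      IsStrat2 gkIsP1 gkEdge σ2 ∧
      ∃ π : ℕ → GKState K,
        IsPlayFrom gkEdge (.s ⟨0, hK⟩) π ∧
        Consistent1 gkIsP1 (MooreStrat m0 αu αn) π ∧
        Consistent2 gkIsP1 σ2 π ∧
        ∃ n j, (v0 j : ℤ) + EL gkW π n j < 0 := by
  obtain ⟨x, q, hx⟩ := exists_phaseSum_large K m0 (gkNext hK αu) (gkOut hK αn) hK hM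
    (∑ i : Fin K, 2 ^ (i : ℕ) * ∑ j, v0 j)
  have hplay := gkPlay_isPlayFrom hK (gkBits hK m0 αu αn x)
  obtain ⟨σ2, hσ, hcons⟩ := exists_strat2_of_play gkIsP1 gkEdge (exists_gkEdge hK) _ hplay.2
  refine ⟨σ2, hσ, _, hplay, gkPlay_consistent1 hK m0 αu αn hleg x, hcons, ?_⟩
  by_contra! hc
  have hsum : phaseSum K m0 (gkNext hK αu) (gkOut hK αn) x q =
      ∑ p ∈ Finset.range q, 2 ^ (p % K) * bitSign (gkBits hK m0 αu αn x p) := rfl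
  rw [hsum, ← gkPlay_weighted_EL hK] at hx
  refine absurd hx (not_lt.2 ((Finset.abs_sum_le_sum_abs _ _).trans ?_))
  push_cast
  refine Finset.sum_le_sum fun i _ => ?_
  rw [abs_mul, abs_of_nonneg (by positivity : (0 : ℤ) ≤ 2 ^ (i : ℕ))]
  refine mul_le_mul_of_nonneg_left ?_ (by positivity)
  have hv : ∀ j, (v0 j : ℤ) ≤ ∑ j, (v0 j : ℤ) := fun j =>
    Finset.single_le_sum (f := fun j => (v0 j : ℤ)) (fun _ _ => by positivity)
      (Finset.mem_univ j)
  have hi : 2 * (i : ℕ) < 2 * K := by omega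
  have hi' : 2 * (i : ℕ) + 1 < 2 * K := by omega
  have h1 := hc (2 * q) ⟨2 * i, hi⟩
  have h2 := hc (2 * q) ⟨2 * i + 1, hi'⟩
  rw [gkPlay_EL_neg] at h2
  exact abs_le.2 ⟨by linarith [hv ⟨2 * i, hi⟩], by linarith [hv ⟨2 * i + 1, hi'⟩]⟩

end Stmt7
end

section
/- Let G be a multi energy game and C ∈ ℕ, with Cpre_C the controllable predecessor operator on subsets of U(C) = S × {0,…,C}^k, and let ≼ be the partial order on U(C) defined by (s,e) ≼ (s',e') iff s = s' and e ≤ e' componentwise. Call V ⊆ U(C) closed if it is upward-closed for ≼. Then Cpre_C maps closed sets to closed sets; consequently, every set U_i in the chain U₀ = U(C), U_{i+1} = Cpre_C(U_i) is closed for ≼. -/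
namespace Stmt10

def UC (S : Type) (k C : ℕ) : Set (S × (Fin k → ℕ)) := {x | ∀ j, x.2 j ≤ C}

def Cpre {S : Type} {k : ℕ} (isP1 : S → Prop) (E : S → S → Prop)
    (w : S → S → Fin k → ℤ) (C : ℕ) (V : Set (S × (Fin k → ℕ))) :
    Set (S × (Fin k → ℕ)) :=
  {x | (∀ j, x.2 j ≤ C) ∧
    ((isP1 x.1 ∧ ∃ s, E x.1 s ∧ ∃ e2 : Fin k → ℕ, (s, e2) ∈ V ∧
        ∀ j, (e2 j : ℤ) ≤ (x.2 j : ℤ) + w x.1 s j) ∨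
     (¬ isP1 x.1 ∧ ∀ s, E x.1 s → ∃ e1 : Fin k → ℕ, (s, e1) ∈ V ∧
        ∀ j, (e1 j : ℤ) ≤ (x.2 j : ℤ) + w x.1 s j))}

/-- `V` is upward closed for the order `(s,e) ≼ (s',e') ↔ s = s' ∧ e ≤ e'`
within `U(C)`. -/
def ClosedSet {S : Type} {k : ℕ} (C : ℕ) (V : Set (S × (Fin k → ℕ))) : Prop :=
  ∀ (s : S) (e e' : Fin k → ℕ), (s, e) ∈ V → (∀ j, e j ≤ e' j) → (∀ j, e' j ≤ C) →
    (s, e') ∈ V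

/-- `Cpre` maps every set of configurations to a closed set. -/
theorem closedSet_cpre {S : Type} {k : ℕ} (isP1 : S → Prop) (E : S → S → Prop)
    (w : S → S → Fin k → ℤ) (C : ℕ) (V : Set (S × (Fin k → ℕ))) :
    ClosedSet C (Cpre isP1 E w C V) := by
  rintro s e e' ⟨-, h⟩ hle hC
  have mono (t : S) (f : Fin k → ℕ) (hf : ∀ j, (f j : ℤ) ≤ (e j : ℤ) + w s t j) (j : Fin k) :
      (f j : ℤ) ≤ (e' j : ℤ) + w s t j := by
    have := hf j
    have := hle j
    omega
  refine ⟨hC, h.imp ?_ ?_⟩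
  · rintro ⟨hs, t, ht, f, hfV, hf⟩
    exact ⟨hs, t, ht, f, hfV, mono t f hf⟩
  · rintro ⟨hs, h⟩
    refine ⟨hs, fun t ht => ?_⟩
    obtain ⟨f, hfV, hf⟩ := h t ht
    exact ⟨f, hfV, mono t f hf⟩

/-- `Cpre_C` maps `≼`-closed subsets of `U(C)` to closed sets, hence every
set of the chain `U_i = Cpre_C^[i](U(C))` is closed. -/
theorem cpre_preserves_closed
    {S : Type} [Fintype S] (isP1 : S → Prop)
    (E : S → S → Prop) (hE : ∀ s, ∃ t, E s t)
    (k : ℕ) (w : S → S → Fin k → ℤ) (C : ℕ) :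
    (∀ V : Set (S × (Fin k → ℕ)), V ⊆ UC S k C → ClosedSet C V →
        ClosedSet C (Cpre isP1 E w C V)) ∧
    (∀ i, ClosedSet C ((Cpre isP1 E w C)^[i] (UC S k C))) := by
  refine ⟨fun V _ _ => closedSet_cpre isP1 E w C V, fun i => ?_⟩
  cases i with
  | zero => exact fun _ _ _ _ _ hC => hC
  | succ i =>
    rw [Function.iterate_succ_apply']
    exact closedSet_cpre isP1 E w C _

end Stmt10
end

section
/- Let G = (S₁, S₂, s_init, E, k, w) be a multi energy game and C ∈ ℕ, and let Cpre_C* denote the greatest fixed point of the operator Cpre_C on subsets of U(C) = S × {0,…,C}^k. If there exists c = (c₁,…,c_k) ∈ {0,…,C}^k with (s_init, c) ∈ Cpre_C*, then P₁ has a pure finite-memory winning strategy for the multi energy objective PosEnergy(c) in G, and the memory needed can be bounded by the number of ≼-minimal elements of Cpre_C* (i.e., a winning Moore machine with at most |Min_≼(Cpre_C*)| memory states exists). -/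
namespace Stmt11

def IsPlayFrom {S : Type} (E : S → S → Prop) (s0 : S) (π : ℕ → S) : Prop :=
  π 0 = s0 ∧ ∀ i, E (π i) (π (i + 1))

def EL {S : Type} {k : ℕ} (w : S → S → Fin k → ℤ) (π : ℕ → S) (n : ℕ) (j : Fin k) : ℤ :=
  ∑ i ∈ Finset.range n, w (π i) (π (i + 1)) j

def PosEnergy {S : Type} {k : ℕ} (w : S → S → Fin k → ℤ) (v0 : Fin k → ℕ) (π : ℕ → S) :
    Prop :=
  ∀ n j, 0 ≤ (v0 j : ℤ) + EL w π n j

def IsStrat1 {S : Type} (isP1 : S → Prop) (E : S → S → Prop) (σ : List S → S → S) : Prop :=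
  ∀ h s, isP1 s → E s (σ h s)

def Hist {S : Type} (π : ℕ → S) (n : ℕ) : List S := (List.range n).map π

def Consistent1 {S : Type} (isP1 : S → Prop) (σ : List S → S → S) (π : ℕ → S) : Prop :=
  ∀ n, isP1 (π n) → π (n + 1) = σ (Hist π n) (π n)

def MooreStrat {S M : Type} (m0 : M) (αu : M → S → M) (αn : M → S → S) :
    List S → S → S :=
  fun h s => αn (h.foldl αu m0) s

def UC (S : Type) (k C : ℕ) : Set (S × (Fin k → ℕ)) := {x | ∀ j, x.2 j ≤ C}

def Cpre {S : Type} {k : ℕ} (isP1 : S → Prop) (E : S → S → Prop)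
    (w : S → S → Fin k → ℤ) (C : ℕ) (V : Set (S × (Fin k → ℕ))) :
    Set (S × (Fin k → ℕ)) :=
  {x | (∀ j, x.2 j ≤ C) ∧
    ((isP1 x.1 ∧ ∃ s, E x.1 s ∧ ∃ e2 : Fin k → ℕ, (s, e2) ∈ V ∧
        ∀ j, (e2 j : ℤ) ≤ (x.2 j : ℤ) + w x.1 s j) ∨
     (¬ isP1 x.1 ∧ ∀ s, E x.1 s → ∃ e1 : Fin k → ℕ, (s, e1) ∈ V ∧
        ∀ j, (e1 j : ℤ) ≤ (x.2 j : ℤ) + w x.1 s j))}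

/-- The set of `≼`-minimal elements of `F`, where `(s,e) ≼ (s',e') ↔ s = s' ∧ e ≤ e'`. -/
def MinElts {S : Type} {k : ℕ} (F : Set (S × (Fin k → ℕ))) : Set (S × (Fin k → ℕ)) :=
  {x ∈ F | ∀ y ∈ F, y.1 = x.1 → (∀ j, y.2 j ≤ x.2 j) → y = x}

theorem finite_UC (S : Type) [Finite S] (k C : ℕ) : (UC S k C).Finite := by
  refine (Set.finite_univ.prod (Set.finite_Icc (0 : Fin k → ℕ) (fun _ => C))).subset ?_
  intro x hx
  exact ⟨Set.mem_univ _, fun _ => Nat.zero_le _, hx⟩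

theorem exists_minElts_le {S : Type} {k : ℕ} {F : Set (S × (Fin k → ℕ))} {s : S}
    {e : Fin k → ℕ} (h : (s, e) ∈ F) :
    ∃ y ∈ MinElts F, y.1 = s ∧ ∀ j, y.2 j ≤ e j := by
  obtain ⟨m, hm, hmin⟩ := exists_minimal_le_of_wellFoundedLT (fun e => (s, e) ∈ F) e h
  refine ⟨(s, m), ⟨hmin.prop, ?_⟩, rfl, hm⟩
  rintro ⟨s', e'⟩ hy rfl hle
  exact Prod.ext rfl (le_antisymm hle (hmin.le_of_le hy hle))

/-- From the position `x`, the game may move to `s` when player 1 follows the choice `t`. -/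
def Leads {S : Type} {k : ℕ} (isP1 : S → Prop) (E : S → S → Prop)
    (t : S × (Fin k → ℕ) → S) (x : S × (Fin k → ℕ)) (s : S) : Prop :=
  E x.1 s ∧ (isP1 x.1 → s = t x)

/-- In a post-fixed point of `Cpre`, player 1 can choose successors so that every move leads to a
minimal element whose credit is covered. -/
theorem exists_choice_of_subset_Cpre {S : Type} {k : ℕ} {isP1 : S → Prop} {E : S → S → Prop}
    {w : S → S → Fin k → ℤ} {C : ℕ} {F : Set (S × (Fin k → ℕ))} (hF : F ⊆ Cpre isP1 E w C F) :
    ∃ t : S × (Fin k → ℕ) → S, (∀ x ∈ F, isP1 x.1 → E x.1 (t x)) ∧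
      ∀ x ∈ F, ∀ s, Leads isP1 E t x s →
        ∃ y ∈ MinElts F, y.1 = s ∧ ∀ j, (y.2 j : ℤ) ≤ x.2 j + w x.1 s j := by
  have hmove : ∀ x : S × (Fin k → ℕ), ∃ t : S, x ∈ F → isP1 x.1 → E x.1 t ∧
      ∃ e, (t, e) ∈ F ∧ ∀ j, (e j : ℤ) ≤ x.2 j + w x.1 t j := by
    intro x
    by_cases hx : x ∈ F ∧ isP1 x.1
    · rcases (hF hx.1).2 with ⟨_, t, ht, he⟩ | ⟨h, _⟩
      · exact ⟨t, fun _ _ => ⟨ht, he⟩⟩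
      · exact absurd hx.2 h
    · exact ⟨x.1, fun h h' => absurd ⟨h, h'⟩ hx⟩
  choose t ht using hmove
  refine ⟨t, fun x hx h => (ht x hx h).1, ?_⟩
  rintro x hx s ⟨hE, hs⟩
  have hcover : ∃ e, (s, e) ∈ F ∧ ∀ j, (e j : ℤ) ≤ x.2 j + w x.1 s j := by
    by_cases h : isP1 x.1
    · rw [hs h]
      exact (ht x hx h).2
    · rcases (hF hx).2 with ⟨h', _⟩ | ⟨_, h'⟩
      · exact absurd h' h
      · exact h' s hE
  obtain ⟨e, he, hle⟩ := hcover
  obtain ⟨y, hy, hys, hye⟩ := exists_minElts_le he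
  exact ⟨y, hy, hys, fun j => (Int.ofNat_le.mpr (hye j)).trans (hle j)⟩

theorem EL_succ {S : Type} {k : ℕ} (w : S → S → Fin k → ℤ) (π : ℕ → S) (n : ℕ) (j : Fin k) :
    EL w π (n + 1) j = EL w π n j + w (π n) (π (n + 1)) j :=
  Finset.sum_range_succ _ _

theorem foldl_Hist_succ {S M : Type} (αu : M → S → M) (m0 : M) (π : ℕ → S) (n : ℕ) :
    (Hist π (n + 1)).foldl αu m0 = αu ((Hist π n).foldl αu m0) (π n) := by
  simp [Hist, List.range_succ]

/-- If player 1 always moves to `s0` from minimal elements, a memoryless strategy wins. -/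
theorem exists_memoryless_of_forall_leads {S : Type} {k : ℕ} {isP1 : S → Prop}
    {E : S → S → Prop} (hE : ∀ s, ∃ t, E s t) {w : S → S → Fin k → ℤ}
    {F : Set (S × (Fin k → ℕ))} {t : S × (Fin k → ℕ) → S} {s0 : S} {c : Fin k → ℕ}
    (ht : ∀ x ∈ F, ∀ s, Leads isP1 E t x s →
      ∃ y ∈ MinElts F, y.1 = s ∧ ∀ j, (y.2 j : ℤ) ≤ x.2 j + w x.1 s j)
    (hc : (s0, c) ∈ F) (hall : ∀ x ∈ MinElts F, Leads isP1 E t x s0) :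
    ∃ αn : Unit → S → S, IsStrat1 isP1 E (MooreStrat () (fun _ _ => ()) αn) ∧
      ∀ π : ℕ → S, IsPlayFrom E s0 π →
        Consistent1 isP1 (MooreStrat () (fun _ _ => ()) αn) π → PosEnergy w c π := by
  classical
  choose succ hsucc using hE
  refine ⟨fun _ s => if E s s0 then s0 else succ s, ?_, ?_⟩
  · intro h s _
    simp only [MooreStrat]
    split_ifs with hs
    exacts [hs, hsucc s]
  · intro π ⟨h0, hπ⟩ hcons
    have inv : ∀ n, ∃ x ∈ MinElts F, x.1 = π n ∧ ∀ j, (x.2 j : ℤ) ≤ c j + EL w π n j := by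
      intro n
      induction n with
      | zero =>
        obtain ⟨x, hx, hxs, hxe⟩ := exists_minElts_le hc
        exact ⟨x, hx, hxs.trans h0.symm, fun j => by simpa [EL] using hxe j⟩
      | succ n ih =>
        obtain ⟨x, hx, hxs, hxe⟩ := ih
        have hl : Leads isP1 E t x (π (n + 1)) := by
          refine ⟨hxs ▸ hπ n, fun hp => ?_⟩
          have h0' := hall x hx
          rw [hcons n (hxs ▸ hp)]
          simp only [MooreStrat]
          rw [if_pos (hxs ▸ h0'.1)]
          exact h0'.2 hp
        obtain ⟨y, hy, hys, hye⟩ := ht x hx.1 _ hl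
        refine ⟨y, hy, hys, fun j => ?_⟩
        have h1 := hye j
        have h2 := hxe j
        rw [hxs] at h1
        rw [EL_succ]
        linarith
    intro n j
    obtain ⟨x, -, -, hx⟩ := inv n
    exact (Int.natCast_nonneg _).trans (hx j)

/-- If some minimal element never leads to `s0`, it can serve as the initial memory state of a
winning Moore machine that records the minimal element reached at the previous step. -/
theorem exists_moore_of_not_leads {S : Type} {k : ℕ} {isP1 : S → Prop}
    {E : S → S → Prop} (hE : ∀ s, ∃ t, E s t) {w : S → S → Fin k → ℤ}
    {F : Set (S × (Fin k → ℕ))} {t : S × (Fin k → ℕ) → S} {s0 : S} {c : Fin k → ℕ}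
    (htE : ∀ x ∈ F, isP1 x.1 → E x.1 (t x))
    (ht : ∀ x ∈ F, ∀ s, Leads isP1 E t x s →
      ∃ y ∈ MinElts F, y.1 = s ∧ ∀ j, (y.2 j : ℤ) ≤ x.2 j + w x.1 s j)
    (hc : (s0, c) ∈ F) (m0 : MinElts F) (hm0 : ¬ Leads isP1 E t m0 s0) :
    ∃ (αu : MinElts F → S → MinElts F) (αn : MinElts F → S → S),
      IsStrat1 isP1 E (MooreStrat m0 αu αn) ∧
      ∀ π : ℕ → S, IsPlayFrom E s0 π →
        Consistent1 isP1 (MooreStrat m0 αu αn) π → PosEnergy w c π := by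
  classical
  choose succ hsucc using hE
  obtain ⟨x0, hx0, hx0s, hx0e⟩ := exists_minElts_le hc
  have hstep : ∀ (x : MinElts F) (s : S), ∃ y : MinElts F, Leads isP1 E t x s →
      y.1.1 = s ∧ ∀ j, (y.1.2 j : ℤ) ≤ x.1.2 j + w x.1.1 s j := by
    intro x s
    by_cases h : Leads isP1 E t x s
    · obtain ⟨y, hy, hy'⟩ := ht x x.2.1 s h
      exact ⟨⟨y, hy⟩, fun _ => hy'⟩
    · exact ⟨x, fun h' => absurd h' h⟩
  choose step hstep using hstep
  set αu : MinElts F → S → MinElts F :=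
    fun m s => if m = m0 ∧ s = s0 then ⟨x0, hx0⟩ else step m s with hαu
  refine ⟨αu, fun m s => if (αu m s).1.1 = s then t (αu m s) else succ s, ?_, ?_⟩
  · intro h s hs
    simp only [MooreStrat]
    split_ifs with hm
    · have := htE _ (αu (h.foldl αu m0) s).2.1 (hm.symm ▸ hs)
      rwa [hm] at this
    · exact hsucc s
  · intro π ⟨h0, hπ⟩ hcons
    have inv : ∀ n, ((Hist π (n + 1)).foldl αu m0).1.1 = π n ∧
        ∀ j, (((Hist π (n + 1)).foldl αu m0).1.2 j : ℤ) ≤ c j + EL w π n j := by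
      intro n
      induction n with
      | zero =>
        have hfirst : (Hist π (0 + 1)).foldl αu m0 = ⟨x0, hx0⟩ := by
          simp [Hist, hαu, h0]
        rw [hfirst]
        exact ⟨hx0s.trans h0.symm, fun j => by simpa [EL] using hx0e j⟩
      | succ n ih =>
        obtain ⟨hxs, hxe⟩ := ih
        rw [foldl_Hist_succ αu m0 π (n + 1)]
        have hl : Leads isP1 E t ((Hist π (n + 1)).foldl αu m0).1 (π (n + 1)) := by
          refine ⟨hxs ▸ hπ n, fun hp => ?_⟩
          have hc' := hcons n (hxs ▸ hp)
          simp only [MooreStrat, ← foldl_Hist_succ] at hc'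
          rwa [if_pos hxs] at hc'
        generalize (Hist π (n + 1)).foldl αu m0 = m at hxs hxe hl ⊢
        have hne : ¬ (m = m0 ∧ π (n + 1) = s0) := by
          rintro ⟨rfl, h⟩
          exact hm0 (h ▸ hl)
        simp only [hαu, if_neg hne]
        obtain ⟨hys, hye⟩ := hstep m _ hl
        refine ⟨hys, fun j => ?_⟩
        have h1 := hye j
        have h2 := hxe j
        rw [hxs] at h1
        rw [EL_succ]
        linarith
    intro n j
    exact (Int.natCast_nonneg _).trans ((inv n).2 j)

/-- correctness: if `(s_init, c) ∈ Cpre_C*` (the greatest fixed point of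
`Cpre_C`), then player 1 has a pure finite-memory winning strategy for `PosEnergy(c)`,
with memory bounded by the number of `≼`-minimal elements of the fixed point. -/
theorem cpre_correctness
    {S : Type} [Fintype S] (isP1 : S → Prop) (sinit : S)
    (E : S → S → Prop) (hE : ∀ s, ∃ t, E s t)
    (k : ℕ) (w : S → S → Fin k → ℤ) (C : ℕ)
    (F : Set (S × (Fin k → ℕ)))
    (hFsub : F ⊆ UC S k C)
    (hFfix : Cpre isP1 E w C F = F)
    (hFgreatest : ∀ V, V ⊆ UC S k C → Cpre isP1 E w C V = V → V ⊆ F)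
    (c : Fin k → ℕ) (hc : ∀ j, c j ≤ C) (hcin : (sinit, c) ∈ F) :
    ∃ (M : Type) (iM : Fintype M) (m0 : M) (αu : M → S → M) (αn : M → S → S),
      @Fintype.card M iM ≤ (MinElts F).ncard ∧
      IsStrat1 isP1 E (MooreStrat m0 αu αn) ∧
      ∀ π : ℕ → S, IsPlayFrom E sinit π →
        Consistent1 isP1 (MooreStrat m0 αu αn) π → PosEnergy w c π := by
  classical
  have hfin : (MinElts F).Finite := (finite_UC S k C).subset fun x hx => hFsub hx.1
  obtain ⟨t, htE, ht⟩ := exists_choice_of_subset_Cpre hFfix.ge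
  by_cases hall : ∀ x ∈ MinElts F, Leads isP1 E t x sinit
  · obtain ⟨αn, hαn⟩ := exists_memoryless_of_forall_leads hE ht hcin hall
    obtain ⟨x, hx, -⟩ := exists_minElts_le hcin
    refine ⟨Unit, inferInstance, (), fun _ _ => (), αn, ?_, hαn⟩
    exact (Set.ncard_pos hfin).mpr ⟨x, hx⟩
  · push Not at hall
    obtain ⟨m0, hm0, hlead⟩ := hall
    obtain ⟨αu, αn, hα⟩ := exists_moore_of_not_leads hE htE ht hcin ⟨m0, hm0⟩ hlead
    refine ⟨MinElts F, hfin.fintype, ⟨m0, hm0⟩, αu, αn, ?_, hα⟩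
    rw [← Nat.card_coe_set_eq, @Nat.card_eq_fintype_card _ hfin.fintype]

end Stmt11
end

section
/- Let ρ₂ = u₀u₁…u_{m−1} be a nonempty finite cyclic sequence over a finite set T in which every element of T occurs. Define the matrix P indexed by T with P(t, t') = occ∘((t,t'), ρ₂) / occ(t, ρ₂), where occ(t, ρ₂) is the number of occurrences of t in ρ₂ and occ∘((t,t'), ρ₂) is the number of cyclic occurrences of the transition (t,t') in ρ₂, and define the vector ν by ν(t) = occ(t, ρ₂)/m. Then P is row-stochastic (each row of P sums to 1), ν is a probability vector, and ν is stationary for P, i.e., for every t' ∈ T, Σ_{t ∈ T} ν(t)·P(t,t') = ν(t'). Moreover, for every transition, ν(t)·P(t,t') = occ∘((t,t'), ρ₂)/m, i.e., the stationary transition frequency equals the cyclic occurrence frequency of that transition in ρ₂. -/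
namespace Stmt14

/-- Number of occurrences of `t` in the cyclic word `u : Fin m → T`. -/
def occ {T : Type} [Fintype T] [DecidableEq T] {m : ℕ} (u : Fin m → T) (t : T) : ℕ :=
  (Finset.univ.filter fun i : Fin m => u i = t).card

/-- Number of cyclic occurrences of the transition `(t, t')` in `u : Fin m → T`. -/
def occCyc {T : Type} [Fintype T] [DecidableEq T] {m : ℕ} (hm : 0 < m)
    (u : Fin m → T) (t t' : T) : ℕ :=
  (Finset.univ.filter fun i : Fin m =>
    u i = t ∧ u ⟨((i : ℕ) + 1) % m, Nat.mod_lt _ hm⟩ = t').card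

theorem cyclic_succ_bijective {m : ℕ} (hm : 0 < m) :
    Function.Bijective fun i : Fin m => (⟨((i : ℕ) + 1) % m, Nat.mod_lt _ hm⟩ : Fin m) := by
  refine Finite.injective_iff_bijective.mp fun i j hij => Fin.ext ?_
  have h : (i : ℕ) + 1 ≡ j + 1 [MOD m] := congrArg Fin.val hij
  exact (Nat.ModEq.add_right_cancel' 1 h).eq_of_lt_of_lt i.isLt j.isLt

theorem sum_occ {T : Type} [Fintype T] [DecidableEq T] {m : ℕ} (u : Fin m → T) :
    ∑ t, occ u t = m := by
  have h := Finset.card_eq_sum_card_fiberwise (s := Finset.univ) (t := Finset.univ)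
    (f := u) (by simp)
  simpa [occ] using h.symm

theorem sum_occCyc_right {T : Type} [Fintype T] [DecidableEq T] {m : ℕ} (hm : 0 < m)
    (u : Fin m → T) (t : T) : ∑ t', occCyc hm u t t' = occ u t := by
  have h := Finset.card_eq_sum_card_fiberwise
    (s := (Finset.univ.filter fun i : Fin m => u i = t)) (t := Finset.univ)
    (f := fun i : Fin m => u ⟨((i : ℕ) + 1) % m, Nat.mod_lt _ hm⟩) (by simp)
  simp only [Finset.filter_filter] at h
  exact h.symm

theorem sum_occCyc_left {T : Type} [Fintype T] [DecidableEq T] {m : ℕ} (hm : 0 < m)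
    (u : Fin m → T) (t' : T) : ∑ t, occCyc hm u t t' = occ u t' := by
  have h := Finset.card_eq_sum_card_fiberwise
    (s := Finset.univ.filter fun i : Fin m => u ⟨((i : ℕ) + 1) % m, Nat.mod_lt _ hm⟩ = t')
    (t := Finset.univ) (f := u) (by simp)
  simp only [Finset.filter_filter, and_comm] at h
  refine h.symm.trans (Finset.card_bijective _ (cyclic_succ_bijective hm) fun i => ?_)
  simp

theorem occ_pos {T : Type} [Fintype T] [DecidableEq T] {m : ℕ} {u : Fin m → T}
    (hsurj : Function.Surjective u) (t : T) : 0 < occ u t := by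
  obtain ⟨i, hi⟩ := hsurj t
  exact Finset.card_pos.mpr ⟨i, by simp [hi]⟩

/-- for a nonempty cyclic word `ρ₂` over `T` in which every element of `T`
occurs, the matrix `P(t,t') = occ∘((t,t'),ρ₂)/occ(t,ρ₂)` is row-stochastic, the vector
`ν(t) = occ(t,ρ₂)/m` is a probability vector, `ν` is stationary for `P`, and
`ν(t)·P(t,t') = occ∘((t,t'),ρ₂)/m`. -/
theorem cyclic_word_stationary_distribution
    {T : Type} [Fintype T] [DecidableEq T]
    (m : ℕ) (hm : 0 < m) (u : Fin m → T) (hsurj : Function.Surjective u)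
    (P : T → T → ℝ) (ν : T → ℝ)
    (hP : ∀ t t', P t t' = (occCyc hm u t t' : ℝ) / (occ u t : ℝ))
    (hν : ∀ t, ν t = (occ u t : ℝ) / (m : ℝ)) :
    (∀ t t', 0 ≤ P t t') ∧
    (∀ t, ∑ t', P t t' = 1) ∧
    (∀ t, 0 ≤ ν t) ∧
    (∑ t, ν t = 1) ∧
    (∀ t', ∑ t, ν t * P t t' = ν t') ∧
    (∀ t t', ν t * P t t' = (occCyc hm u t t' : ℝ) / (m : ℝ)) := by
  have hm' : (m : ℝ) ≠ 0 := by exact_mod_cast hm.ne'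
  have hocc (t : T) : (occ u t : ℝ) ≠ 0 := by exact_mod_cast (occ_pos hsurj t).ne'
  have hfreq (t t' : T) : ν t * P t t' = (occCyc hm u t t' : ℝ) / (m : ℝ) := by
    rw [hν, hP]
    field_simp [hocc t]
  refine ⟨fun t t' => ?_, fun t => ?_, fun t => ?_, ?_, fun t' => ?_, hfreq⟩
  · rw [hP]
    positivity
  · simp only [hP]
    rw [← Finset.sum_div, ← Nat.cast_sum, sum_occCyc_right, div_self (hocc t)]
  · rw [hν]
    positivity
  · simp only [hν]
    rw [← Finset.sum_div, ← Nat.cast_sum, sum_occ, div_self hm']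
  · simp only [hfreq]
    rw [← Finset.sum_div, ← Nat.cast_sum, sum_occCyc_left, hν]

end Stmt14
end

section
/- Consider the one-player game with states s₀ and s₁ (both controlled by P₁), initial state s₀, edges (s₀,s₀) with weight (1,−1), (s₀,s₁) with weight (0,0), and (s₁,s₁) with weight (−1,1). Then for every play π from s₀: either π never takes the edge (s₀,s₁), in which case MP(π) = (1,−1), or π eventually reaches s₁ and stays there forever, in which case MP(π) = (−1,1). In particular, no play — and hence no pure strategy of P₁, regardless of its (even infinite) amount of memory — achieves mean-payoff (0,0). -/
namespace Stmt15

def EL {S : Type} {k : ℕ} (w : S → S → Fin k → ℤ) (π : ℕ → S) (n : ℕ) (j : Fin k) : ℤ :=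
  ∑ i ∈ Finset.range n, w (π i) (π (i + 1)) j

/-- The game of Fig. "satis_expect" restricted to the reachable part: states
`false = s₀` and `true = s₁`, edges `s₀→s₀`, `s₀→s₁`, `s₁→s₁` (no edge `s₁→s₀`). -/
def edge : Bool → Bool → Prop := fun a b => ¬ (a = true ∧ b = false)

/-- Weights: `w(s₀,s₀) = (1,−1)`, `w(s₀,s₁) = (0,0)`, `w(s₁,s₁) = (−1,1)`. -/
def wt : Bool → Bool → Fin 2 → ℤ :=
  fun a b j =>
    match a, b with
    | false, false => if (j : ℕ) = 0 then 1 else -1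
    | false, true => 0
    | true, true => if (j : ℕ) = 0 then -1 else 1
    | true, false => 0

/-- Mean-payoff of a play in dimension `j` (liminf of average energy levels). -/
noncomputable def mp (π : ℕ → Bool) (j : Fin 2) : ℝ :=
  Filter.liminf (fun n => (EL wt π n j : ℝ) / n) Filter.atTop

/-- If the weight in dimension `j` is eventually constant along a play, the mean-payoff
in dimension `j` is that constant. -/
lemma mp_eq_of_eventually_const {π : ℕ → Bool} {j : Fin 2} {c : ℤ}
    (h : ∀ᶠ i in Filter.atTop, wt (π i) (π (i + 1)) j = c) : mp π j = c := by
  have hlim : Filter.Tendsto (fun i => (wt (π i) (π (i + 1)) j : ℝ)) Filter.atTop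
      (nhds (c : ℝ)) :=
    tendsto_const_nhds.congr' (h.mono fun i hi => by simp [hi])
  refine (hlim.cesaro.congr fun n => ?_).liminf_eq
  simp only [EL, Int.cast_sum]
  ring

/-- State `true` is absorbing. -/
lemma eq_true_of_le {π : ℕ → Bool} (hπ : ∀ i, edge (π i) (π (i + 1))) {N n : ℕ}
    (hN : π N = true) (hn : N ≤ n) : π n = true := by
  induction n, hn using Nat.le_induction with
  | base => exact hN
  | succ n _ ih => simpa [edge, ih] using hπ n

/-- every play of this one-player game either always stays in `s₀` and has
mean-payoff `(1,−1)`, or eventually reaches `s₁` and stays there forever, with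
mean-payoff `(−1,1)`; in particular no play (hence no pure strategy of player 1, with
any amount of memory) achieves mean-payoff `(0,0)`. -/
theorem no_play_achieves_zero (π : ℕ → Bool) (h0 : π 0 = false)
    (hπ : ∀ i, edge (π i) (π (i + 1))) :
    (((∀ n, π n = false) ∧ mp π 0 = 1 ∧ mp π 1 = -1) ∨
      ((∃ N, ∀ n, N ≤ n → π n = true) ∧ mp π 0 = -1 ∧ mp π 1 = 1)) ∧
    ¬ (mp π 0 = 0 ∧ mp π 1 = 0) := by
  have key : ((∀ n, π n = false) ∧ mp π 0 = 1 ∧ mp π 1 = -1) ∨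
      ((∃ N, ∀ n, N ≤ n → π n = true) ∧ mp π 0 = -1 ∧ mp π 1 = 1) := by
    by_cases h : ∀ n, π n = false
    · refine Or.inl ⟨h, ?_, ?_⟩
      · simpa using mp_eq_of_eventually_const (π := π) (j := 0) (c := 1)
          (Filter.Eventually.of_forall fun i => by simp [wt, h])
      · simpa using mp_eq_of_eventually_const (π := π) (j := 1) (c := -1)
          (Filter.Eventually.of_forall fun i => by simp [wt, h])
    · obtain ⟨N, hN⟩ := not_forall.mp h
      have hT : ∀ n, N ≤ n → π n = true := fun n hn =>
        eq_true_of_le hπ (by simpa using hN) hn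
      refine Or.inr ⟨⟨N, hT⟩, ?_, ?_⟩
      · simpa using mp_eq_of_eventually_const (π := π) (j := 0) (c := -1)
          ((Filter.eventually_ge_atTop N).mono fun i hi => by
            simp [wt, hT i hi, hT (i + 1) (by omega)])
      · simpa using mp_eq_of_eventually_const (π := π) (j := 1) (c := 1)
          ((Filter.eventually_ge_atTop N).mono fun i hi => by
            simp [wt, hT i hi, hT (i + 1) (by omega)])
  refine ⟨key, fun ⟨hz, _⟩ => ?_⟩
  rcases key with ⟨_, h, _⟩ | ⟨_, h, _⟩ <;> norm_num [hz] at h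

end Stmt15
end

section
/- Let G = (S₁, S₂, s_init, E, w, F) be a two-player game with one-dimensional weights w : E → ℤ and Büchi set F ⊆ S, and let Win ⊆ S be the set of states s from which P₁ has a winning strategy for the mean-payoff Büchi objective with threshold 0 (all consistent plays from s satisfy MP(π) ≥ 0 and visit F infinitely often). Then P₁ has a single (uniform) pure memoryless strategy λ^gfe defined on Win such that: every play starting from any state of Win consistent with λ^gfe remains forever inside Win, and every cycle formed along such a play (every finite consistent path s₀…s_n with s₀ = s_n) has energy level EL ≥ 0. -/
namespace Stmt16

def IsPlayFrom {S : Type} (E : S → S → Prop) (s0 : S) (π : ℕ → S) : Prop :=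
  π 0 = s0 ∧ ∀ i, E (π i) (π (i + 1))

/-- One-dimensional energy level of a prefix. -/
def EL1 {S : Type} (w : S → S → ℤ) (π : ℕ → S) (n : ℕ) : ℤ :=
  ∑ i ∈ Finset.range n, w (π i) (π (i + 1))

def IsStrat1 {S : Type} (isP1 : S → Prop) (E : S → S → Prop) (σ : List S → S → S) : Prop :=
  ∀ h s, isP1 s → E s (σ h s)

def Hist {S : Type} (π : ℕ → S) (n : ℕ) : List S := (List.range n).map π

def Consistent1 {S : Type} (isP1 : S → Prop) (σ : List S → S → S) (π : ℕ → S) : Prop :=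
  ∀ n, isP1 (π n) → π (n + 1) = σ (Hist π n) (π n)

/-- Mean-payoff of a play (liminf of average energy levels). -/
noncomputable def MP {S : Type} (w : S → S → ℤ) (π : ℕ → S) : ℝ :=
  Filter.liminf (fun n => (EL1 w π n : ℝ) / n) Filter.atTop

/-- The set of states from which player 1 wins the mean-payoff Büchi objective with
threshold `0`: all consistent plays have mean-payoff `≥ 0` and visit `F` infinitely
often. -/
def WinMPB {S : Type} (isP1 : S → Prop) (E : S → S → Prop)
    (w : S → S → ℤ) (F : Set S) : Set S :=
  {s | ∃ σ : List S → S → S, IsStrat1 isP1 E σ ∧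
    ∀ π : ℕ → S, IsPlayFrom E s π → Consistent1 isP1 σ π →
      0 ≤ MP w π ∧ ∀ N, ∃ n, N ≤ n ∧ π n ∈ F}

/-- `σ` is a winning strategy of player 1 from `s` for the mean-payoff Büchi objective. -/
def WinsFrom {S : Type} (isP1 : S → Prop) (E : S → S → Prop) (w : S → S → ℤ) (F : Set S)
    (σ : List S → S → S) (s : S) : Prop :=
  IsStrat1 isP1 E σ ∧ ∀ π : ℕ → S, IsPlayFrom E s π → Consistent1 isP1 σ π →
    0 ≤ MP w π ∧ ∀ N, ∃ n, N ≤ n ∧ π n ∈ F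

/-- Starting from `s` with credit `c`, player 1 can keep the energy nonnegative for `k` steps
while moving only to states of `A`. -/
def Survives {S : Type} (isP1 : S → Prop) (E : S → S → Prop) (w : S → S → ℤ) (A : Set S) :
    ℕ → S → ℤ → Prop
  | 0, _, c => 0 ≤ c
  | k + 1, s, c => 0 ≤ c ∧
      (isP1 s → ∃ t, E s t ∧ t ∈ A ∧ Survives isP1 E w A k t (c + w s t)) ∧
      (¬ isP1 s → ∀ t, E s t → Survives isP1 E w A k t (c + w s t))

theorem exists_weight_bound {S : Type} [Finite S] (w : S → S → ℤ) :
    ∃ W : ℤ, 0 ≤ W ∧ ∀ s t, |w s t| ≤ W := by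
  obtain ⟨W, hW⟩ := Finite.exists_le (fun p : S × S => |w p.1 p.2|)
  exact ⟨max W 0, le_max_right _ _, fun s t => (hW (s, t)).trans (le_max_left _ _)⟩

theorem abs_EL1_le {S : Type} {w : S → S → ℤ} {W : ℤ} (hW : ∀ s t, |w s t| ≤ W)
    (π : ℕ → S) (n : ℕ) : |EL1 w π n| ≤ n * W := by
  calc |EL1 w π n| ≤ ∑ i ∈ Finset.range n, |w (π i) (π (i + 1))| :=
        Finset.abs_sum_le_sum_abs _ _
    _ ≤ ∑ _i ∈ Finset.range n, W := Finset.sum_le_sum fun i _ => hW _ _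
    _ = n * W := by simp

theorem zero_le_MP_iff {S : Type} [Finite S] (w : S → S → ℤ) (π : ℕ → S) :
    0 ≤ MP w π ↔ ∀ ε : ℝ, 0 < ε → ∀ᶠ n : ℕ in Filter.atTop, -(ε * n) < (EL1 w π n : ℝ) := by
  obtain ⟨W, hW0, hW⟩ := exists_weight_bound w
  have habs : ∀ n : ℕ, |(EL1 w π n : ℝ) / n| ≤ W := by
    intro n
    have h : |(EL1 w π n : ℝ)| ≤ n * W := by exact_mod_cast abs_EL1_le hW π n
    rw [abs_div, Nat.abs_cast]
    refine div_le_of_le_mul₀ (Nat.cast_nonneg n) (by exact_mod_cast hW0) ?_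
    linarith
  have hbdd : Filter.IsBoundedUnder (· ≥ ·) Filter.atTop (fun n : ℕ => (EL1 w π n : ℝ) / n) :=
    Filter.isBoundedUnder_of ⟨-(W : ℝ), fun n => (abs_le.1 (habs n)).1⟩
  have hcobdd : Filter.IsCoboundedUnder (· ≥ ·) Filter.atTop
      (fun n : ℕ => (EL1 w π n : ℝ) / n) :=
    (Filter.isBoundedUnder_of ⟨(W : ℝ), fun n => (abs_le.1 (habs n)).2⟩ :
      Filter.IsBoundedUnder (· ≤ ·) Filter.atTop _).isCoboundedUnder_ge
  rw [MP, Filter.le_liminf_iff hcobdd hbdd]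
  constructor
  · intro h ε hε
    filter_upwards [h (-ε) (by linarith), Filter.eventually_gt_atTop 0] with n hn hn0
    rw [lt_div_iff₀ (by exact_mod_cast hn0)] at hn
    linarith
  · intro h y hy
    filter_upwards [h (-y) (by linarith), Filter.eventually_gt_atTop 0] with n hn hn0
    rw [lt_div_iff₀ (by exact_mod_cast hn0)]
    linarith

theorem EL1_succ' {S : Type} (w : S → S → ℤ) (π : ℕ → S) (n : ℕ) :
    EL1 w π (n + 1) = w (π 0) (π 1) + EL1 w (fun i => π (i + 1)) n := by
  simp only [EL1, Finset.sum_range_succ', zero_add]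
  ring

theorem zero_le_MP_tail {S : Type} [Finite S] {w : S → S → ℤ} {π : ℕ → S} (h : 0 ≤ MP w π) :
    0 ≤ MP w (fun i => π (i + 1)) := by
  rw [zero_le_MP_iff] at h ⊢
  intro ε hε
  have h1 := (Filter.tendsto_add_atTop_nat 1).eventually (h (ε / 2) (by linarith))
  obtain ⟨N, hN⟩ := exists_nat_gt ((ε / 2 + w (π 0) (π 1)) / (ε / 2))
  filter_upwards [h1, Filter.eventually_ge_atTop N] with n hn hnN
  rw [EL1_succ'] at hn
  push_cast at hn
  rw [div_lt_iff₀ (by linarith)] at hN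
  have hNn : (N : ℝ) ≤ n := by exact_mod_cast hnN
  nlinarith

theorem Hist_succ {S : Type} (π : ℕ → S) (n : ℕ) : Hist π (n + 1) = Hist π n ++ [π n] := by
  simp [Hist, List.range_succ]

theorem Hist_succ' {S : Type} (π : ℕ → S) (n : ℕ) :
    Hist π (n + 1) = π 0 :: Hist (fun i => π (i + 1)) n := by
  simp [Hist, List.range_succ_eq_map, Function.comp_def]

section Game

variable {S : Type} {isP1 : S → Prop} {E : S → S → Prop} {w : S → S → ℤ} {F : Set S}

theorem Survives.nonneg {A : Set S} {k : ℕ} {s : S} {c : ℤ}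
    (h : Survives isP1 E w A k s c) : 0 ≤ c := by
  cases k with
  | zero => exact h
  | succ k => exact h.1

theorem Survives.mono {A : Set S} {k : ℕ} {s : S} {c d : ℤ}
    (h : Survives isP1 E w A k s c) (hcd : c ≤ d) : Survives isP1 E w A k s d := by
  induction k generalizing s c d with
  | zero => exact le_trans h hcd
  | succ k ih =>
    refine ⟨h.1.trans hcd, fun hP => ?_, fun hP t ht => ih (h.2.2 hP t ht) (by linarith)⟩
    obtain ⟨t, ht, htA, hk⟩ := h.2.1 hP
    exact ⟨t, ht, htA, ih hk (by linarith)⟩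

theorem Survives.pred {A : Set S} {k : ℕ} {s : S} {c : ℤ}
    (h : Survives isP1 E w A (k + 1) s c) : Survives isP1 E w A k s c := by
  induction k generalizing s c with
  | zero => exact h.1
  | succ k ih =>
    refine ⟨h.1, fun hP => ?_, fun hP t ht => ih (h.2.2 hP t ht)⟩
    obtain ⟨t, ht, htA, hk⟩ := h.2.1 hP
    exact ⟨t, ht, htA, ih hk⟩

theorem Survives.anti {A : Set S} {k l : ℕ} {s : S} {c : ℤ}
    (h : Survives isP1 E w A l s c) (hkl : k ≤ l) : Survives isP1 E w A k s c := by
  induction hkl with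
  | refl => exact h
  | step _ ih => exact ih h.pred

variable [Finite S]

theorem WinsFrom.residual {σ : List S → S → S} {s t : S}
    (hσ : WinsFrom isP1 E w F σ s) (hst : E s t) (ht : isP1 s → t = σ [] s) :
    WinsFrom isP1 E w F (fun h => σ (s :: h)) t := by
  refine ⟨fun h x hx => hσ.1 _ x hx, fun π hπ hc => ?_⟩
  obtain ⟨ρ, hρ0, hρs⟩ : ∃ ρ : ℕ → S, ρ 0 = s ∧ (fun n => ρ (n + 1)) = π :=
    ⟨fun n => Nat.casesOn n s π, rfl, rfl⟩
  have hρn : ∀ n, ρ (n + 1) = π n := fun n => congrFun hρs n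
  have hρ : IsPlayFrom E s ρ := by
    refine ⟨hρ0, fun i => ?_⟩
    cases i with
    | zero => rwa [hρn, hρ0, hπ.1]
    | succ i => rw [hρn, hρn]; exact hπ.2 i
  have hρc : Consistent1 isP1 σ ρ := by
    intro n hn
    cases n with
    | zero =>
      rw [hρ0] at hn ⊢
      rw [hρn, hπ.1]
      exact ht hn
    | succ n =>
      rw [hρn] at hn
      rw [Hist_succ', hρn, hρn, hρ0, hρs]
      exact hc n hn
  obtain ⟨hmp, hF⟩ := hσ.2 ρ hρ hρc
  refine ⟨hρs ▸ zero_le_MP_tail hmp, fun N => ?_⟩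
  obtain ⟨n, hn, hnF⟩ := hF (N + 1)
  obtain ⟨m, rfl⟩ : ∃ m, n = m + 1 := ⟨n - 1, by omega⟩
  exact ⟨m, by omega, hρn m ▸ hnF⟩

theorem mem_WinMPB_of_edge {s t : S} (hs : s ∈ WinMPB isP1 E w F)
    (hP : ¬ isP1 s) (hst : E s t) : t ∈ WinMPB isP1 E w F := by
  obtain ⟨σ, hσ⟩ := hs
  exact ⟨_, WinsFrom.residual hσ hst fun h => absurd h hP⟩

theorem exists_edge_mem_WinMPB {s : S} (hs : s ∈ WinMPB isP1 E w F) (hP : isP1 s) :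
    ∃ t, E s t ∧ t ∈ WinMPB isP1 E w F := by
  obtain ⟨σ, hσ⟩ := hs
  exact ⟨σ [] s, hσ.1 _ _ hP, _, WinsFrom.residual hσ (hσ.1 _ _ hP) fun _ => rfl⟩

theorem survives_mul_bound {W : ℤ} (hW0 : 0 ≤ W) (hW : ∀ s t, |w s t| ≤ W)
    (k : ℕ) {s : S} (hs : s ∈ WinMPB isP1 E w F) :
    Survives isP1 E w (WinMPB isP1 E w F) k s (k * W) := by
  induction k generalizing s with
  | zero => simp [Survives]
  | succ k ih =>
    have hle : ∀ t, (k : ℤ) * W ≤ ((k + 1 : ℕ) : ℤ) * W + w s t := fun t => by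
      push_cast
      linarith [(abs_le.1 (hW s t)).1]
    refine ⟨by positivity, fun hP => ?_, fun hP t ht =>
      (ih (mem_WinMPB_of_edge hs hP ht)).mono (hle t)⟩
    obtain ⟨t, ht, htA⟩ := exists_edge_mem_WinMPB hs hP
    exact ⟨t, ht, htA, (ih htA).mono (hle t)⟩

/-- Otherwise player 2 could repeatedly force the energy to drop within a bounded number of steps,
which makes the mean-payoff negative. -/
theorem exists_credit_of_mem_WinMPB {s : S} (hs : s ∈ WinMPB isP1 E w F) :
    ∃ c, ∀ k, Survives isP1 E w (WinMPB isP1 E w F) k s c := by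
  classical
  set A := WinMPB isP1 E w F
  by_contra hcon
  push Not at hcon
  obtain ⟨W, hW0, hW⟩ := exists_weight_bound w
  obtain ⟨B, hB0, hB⟩ : ∃ B : ℤ, 0 ≤ B ∧ ∀ t, (∃ c, ∀ k, Survives isP1 E w A k t c) →
      ∀ k, Survives isP1 E w A k t B := by
    have h : ∀ t, ∃ c, (∃ c, ∀ k, Survives isP1 E w A k t c) →
        ∀ k, Survives isP1 E w A k t c := fun t => by
      by_cases ht : ∃ c, ∀ k, Survives isP1 E w A k t c
      · exact ht.imp fun c hc _ => hc
      · exact ⟨0, fun h => absurd h ht⟩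
    choose b hb using h
    obtain ⟨B, hB⟩ := Finite.exists_le b
    exact ⟨max B 0, le_max_right _ _, fun t ht k =>
      (hb t ht k).mono ((hB t).trans (le_max_left _ _))⟩
  obtain ⟨K, hK⟩ : ∃ K : ℕ, ∀ t, (∀ c, ∃ k, ¬ Survives isP1 E w A k t c) →
      ¬ Survives isP1 E w A K t (B + W) := by
    have h : ∀ t, ∃ k, (∀ c, ∃ k, ¬ Survives isP1 E w A k t c) →
        ¬ Survives isP1 E w A k t (B + W) := fun t => by
      by_cases ht : ∀ c, ∃ k, ¬ Survives isP1 E w A k t c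
      · exact (ht (B + W)).imp fun c hc _ => hc
      · exact ⟨0, fun h => absurd h ht⟩
    choose b hb using h
    obtain ⟨K, hK⟩ := Finite.exists_le b
    exact ⟨K, fun t ht hS => hb t ht (hS.anti (hK t))⟩
  obtain ⟨σ, hσ⟩ := id hs
  let Inv : S × List S × ℤ × ℕ → Prop := fun q =>
    WinsFrom isP1 E w F (fun l => σ (q.2.1 ++ l)) q.1 ∧ B + W ≤ q.2.2.1 ∧ q.2.2.2 ≤ K ∧
      ¬ Survives isP1 E w A q.2.2.2 q.1 q.2.2.1
  have hstep : ∀ q : {q // Inv q}, ∃ q' : {q // Inv q},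
      E q.1.1 q'.1.1 ∧ q'.1.2.1 = q.1.2.1 ++ [q.1.1] ∧
      (isP1 q.1.1 → q'.1.1 = σ q.1.2.1 q.1.1) ∧
      (K + 1) * (w q.1.1 q'.1.1 - q'.1.2.2.1 + q.1.2.2.1) + q'.1.2.2.2 - q.1.2.2.2 ≤ -1 := by
    rintro ⟨⟨x, h, c, j⟩, hwin, hc, hj, hns⟩
    simp only at hwin hc hj hns
    obtain ⟨i, rfl⟩ : ∃ i, j = i + 1 := by
      cases j with
      | zero => exact absurd (show (0 : ℤ) ≤ c by linarith) hns
      | succ i => exact ⟨i, rfl⟩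
    obtain ⟨t, hxt, htσ, htns⟩ : ∃ t, E x t ∧ (isP1 x → t = σ h x) ∧
        ¬ Survives isP1 E w A i t (c + w x t) := by
      by_cases hP : isP1 x
      · have hE' : E x (σ h x) := by simpa using hwin.1 [] x hP
        refine ⟨σ h x, hE', fun _ => rfl, fun hS => hns ?_⟩
        refine ⟨by linarith, fun _ => ⟨_, hE', ?_, hS⟩, fun h' => absurd hP h'⟩
        exact ⟨_, hwin.residual hE' fun _ => by simp⟩
      · by_contra hno
        push Not at hno
        exact hns ⟨by linarith, fun h' => absurd h' hP,
          fun _ t ht => hno t ht fun h' => absurd h' hP⟩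
    have hwin' : WinsFrom isP1 E w F (fun l => σ ((h ++ [x]) ++ l)) t := by
      simpa using hwin.residual hxt (by simpa using htσ)
    by_cases hge : B + W ≤ c + w x t
    · refine ⟨⟨(t, h ++ [x], c + w x t, i), hwin', hge, by simp only; omega, htns⟩,
        hxt, rfl, htσ, ?_⟩
      simp only
      push_cast
      linarith
    · have htU : ∀ c, ∃ k, ¬ Survives isP1 E w A k t c := by
        by_contra hno
        push Not at hno
        exact htns ((hB t hno i).mono (by linarith [(abs_le.1 (hW x t)).1]))
      refine ⟨⟨(t, h ++ [x], B + W, K), hwin', le_rfl, le_rfl, hK t htU⟩, hxt, rfl, htσ, ?_⟩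
      simp only
      push_cast
      have : w x t - (B + W) + c ≤ -1 := by omega
      nlinarith
  choose next hnext using hstep
  let q₀ : {q // Inv q} := ⟨(s, [], B + W, K), hσ, le_rfl, le_rfl, hK s hcon⟩
  let q : ℕ → {q // Inv q} := fun n => next^[n] q₀
  have hq : ∀ n, q (n + 1) = next (q n) := fun n => Function.iterate_succ_apply' _ _ _
  let π : ℕ → S := fun n => (q n).1.1
  have hhist : ∀ n, (q n).1.2.1 = Hist π n := by
    intro n
    induction n with
    | zero => rfl
    | succ n ih => rw [hq, (hnext (q n)).2.1, ih, Hist_succ]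
  have hplay : IsPlayFrom E s π := ⟨rfl, fun i => by
    have := (hnext (q i)).1
    rwa [← hq] at this⟩
  have hcons : Consistent1 isP1 σ π := fun n hn => by
    have := (hnext (q n)).2.2.1 hn
    rwa [← hq, hhist] at this
  have hpot : ∀ n : ℕ, (K + 1) * (EL1 w π n - (q n).1.2.2.1) + (q n).1.2.2.2 ≤
      (K + 1) * (-(B + W)) + K - n := by
    intro n
    induction n with
    | zero => simp [EL1, q, q₀]
    | succ n ih =>
      have h := (hnext (q n)).2.2.2
      rw [← hq] at h
      have hEL : EL1 w π (n + 1) = EL1 w π n + w (q n).1.1 (q (n + 1)).1.1 :=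
        Finset.sum_range_succ _ _
      rw [hEL]
      push_cast
      linarith
  have hcredit : ∀ n, (q n).1.2.2.1 ≤ K * W := by
    intro n
    obtain ⟨hwin, -, hj, hns⟩ := (q n).2
    by_contra hlt
    push Not at hlt
    exact hns (((survives_mul_bound hW0 hW K ⟨_, hwin⟩).anti hj).mono hlt.le)
  have hmp := (zero_le_MP_iff w π).1 (hσ.2 π hplay hcons).1 (1 / (2 * (K + 1))) (by positivity)
  obtain ⟨N, hN⟩ := Filter.eventually_atTop.1 hmp
  obtain ⟨D, hD⟩ : ∃ D : ℕ, ((K + 1) * (K * W) + K : ℤ) ≤ D :=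
    ⟨_, Int.self_le_toNat _⟩
  have h1 := hN (N + 2 * D + 1) (by omega)
  have h2 : ((K : ℤ) + 1) * EL1 w π (N + 2 * D + 1) ≤ D - (N + 2 * D + 1 : ℕ) := by
    have h3 := hpot (N + 2 * D + 1)
    have h4 := hcredit (N + 2 * D + 1)
    nlinarith
  have h2' : ((K : ℝ) + 1) * EL1 w π (N + 2 * D + 1) ≤ D - (N + 2 * D + 1 : ℕ) := by
    exact_mod_cast h2
  have hKpos : (0 : ℝ) < K + 1 := by positivity
  have h5 := mul_lt_mul_of_pos_left h1 hKpos
  have h6 : ((K : ℝ) + 1) * -(1 / (2 * (K + 1)) * ((N + 2 * D + 1 : ℕ) : ℝ)) =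
      -(((N + 2 * D + 1 : ℕ) : ℝ) / 2) := by
    field_simp
  rw [h6] at h5
  push_cast at h5 h2'
  have : (0 : ℝ) ≤ N := Nat.cast_nonneg N
  linarith

/-- An energy potential on the winning set: along suitable player 1 moves and all player 2 moves
it increases by at most the weight of the edge. -/
theorem exists_energy_potential (isP1 : S → Prop) (E : S → S → Prop) (w : S → S → ℤ)
    (F : Set S) :
    ∃ v : S → ℤ, ∀ s ∈ WinMPB isP1 E w F,
      (isP1 s → ∃ t, E s t ∧ t ∈ WinMPB isP1 E w F ∧ v t ≤ v s + w s t) ∧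
      (¬ isP1 s → ∀ t, E s t → v t ≤ v s + w s t) := by
  classical
  set A := WinMPB isP1 E w F
  have hmin : ∀ s, ∃ c : ℤ, s ∈ A → (∀ k, Survives isP1 E w A k s c) ∧
      ∀ d, (∀ k, Survives isP1 E w A k s d) → c ≤ d := by
    intro s
    by_cases hs : s ∈ A
    · obtain ⟨c, hc, hle⟩ := Int.exists_least_of_bdd
        (P := fun c => ∀ k, Survives isP1 E w A k s c)
        ⟨0, fun z hz => (hz 0).nonneg⟩ (exists_credit_of_mem_WinMPB hs)
      exact ⟨c, fun _ => ⟨hc, hle⟩⟩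
    · exact ⟨0, fun h => absurd h hs⟩
  choose v hv using hmin
  refine ⟨v, fun s hs => ⟨fun hP => ?_, fun hP t ht => ?_⟩⟩
  · by_contra hno
    push Not at hno
    have hfail : ∀ t, ∃ k, E s t → t ∈ A → ¬ Survives isP1 E w A k t (v s + w s t) := by
      intro t
      by_contra hall
      push Not at hall
      have h0 := hall 0
      exact absurd ((hv t h0.2.1).2 _ fun k => (hall k).2.2) (hno t h0.1 h0.2.1).not_ge
    choose b hb using hfail
    obtain ⟨K, hK⟩ := Finite.exists_le b
    obtain ⟨t, ht, htA, hS⟩ := ((hv s hs).1 (K + 1)).2.1 hP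
    exact hb t ht htA (hS.anti (hK t))
  · exact (hv t (mem_WinMPB_of_edge hs hP ht)).2 _ fun k => ((hv s hs).1 (k + 1)).2.2 hP t ht

end Game

/-- in a mean-payoff Büchi game, player 1 has a single uniform pure
memoryless good-for-energy strategy `f` on the winning set `Win`: consistent plays from
any state of `Win` stay in `Win`, and every cycle formed along such a play has
nonnegative energy level. -/
theorem good_for_energy_strategy
    {S : Type} [Fintype S] (isP1 : S → Prop)
    (E : S → S → Prop) (hE : ∀ s, ∃ t, E s t)
    (w : S → S → ℤ) (F : Set S) :
    ∃ f : S → S,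
      (∀ s ∈ WinMPB isP1 E w F, isP1 s → E s (f s)) ∧
      ∀ s ∈ WinMPB isP1 E w F, ∀ π : ℕ → S, IsPlayFrom E s π →
        Consistent1 isP1 (fun _ t => f t) π →
        (∀ n, π n ∈ WinMPB isP1 E w F) ∧
        (∀ n n', n < n' → π n = π n' →
          0 ≤ ∑ i ∈ Finset.Ico n n', w (π i) (π (i + 1))) := by
  classical
  obtain ⟨v, hv⟩ := exists_energy_potential isP1 E w F
  have hf : ∀ s, ∃ t, s ∈ WinMPB isP1 E w F → isP1 s →
      E s t ∧ t ∈ WinMPB isP1 E w F ∧ v t ≤ v s + w s t := by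
    intro s
    by_cases h : s ∈ WinMPB isP1 E w F ∧ isP1 s
    · exact ((hv s h.1).1 h.2).imp fun t ht _ _ => ht
    · exact ⟨s, fun h1 h2 => absurd ⟨h1, h2⟩ h⟩
  choose f hf using hf
  refine ⟨f, fun s hs hP => (hf s hs hP).1, fun s hs π hπ hc => ?_⟩
  have hstep : ∀ n, π n ∈ WinMPB isP1 E w F →
      π (n + 1) ∈ WinMPB isP1 E w F ∧ v (π (n + 1)) ≤ v (π n) + w (π n) (π (n + 1)) := by
    intro n hn
    by_cases hP : isP1 (π n)
    · rw [hc n hP]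
      exact (hf _ hn hP).2
    · exact ⟨mem_WinMPB_of_edge hn hP (hπ.2 n), (hv _ hn).2 hP _ (hπ.2 n)⟩
  have hmem : ∀ n, π n ∈ WinMPB isP1 E w F := by
    intro n
    induction n with
    | zero => rwa [hπ.1]
    | succ n ih => exact (hstep n ih).1
  refine ⟨hmem, fun n n' hn heq => ?_⟩
  calc (0 : ℤ) = v (π n') - v (π n) := by rw [heq, sub_self]
    _ = ∑ i ∈ Finset.Ico n n', (v (π (i + 1)) - v (π i)) :=
        (Finset.sum_Ico_sub (fun i => v (π i)) hn.le).symm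
    _ ≤ _ := Finset.sum_le_sum fun i _ => by linarith [(hstep i (hmem i)).2]

end Stmt16
end

section
/- Let G = (S₁, S₂, s_init, E, w, F) be a two-player game with one-dimensional weights w : E → ℤ and Büchi set F ⊆ S, and let Win ⊆ S be the set of states from which P₁ has a winning strategy for the mean-payoff Büchi objective with threshold 0. Then for every ε > 0 and every s ∈ Win, P₁ has a pure finite-memory strategy λ₁ (encoded by a deterministic Moore machine) such that every play from s consistent with λ₁ visits F infinitely often and has mean-payoff MP(π) ≥ −ε. That is, in mean-payoff Büchi games, ε-optimality can be achieved surely by pure finite-memory strategies. -/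
namespace Stmt17

def IsPlayFrom {S : Type} (E : S → S → Prop) (s0 : S) (π : ℕ → S) : Prop :=
  π 0 = s0 ∧ ∀ i, E (π i) (π (i + 1))

def EL1 {S : Type} (w : S → S → ℤ) (π : ℕ → S) (n : ℕ) : ℤ :=
  ∑ i ∈ Finset.range n, w (π i) (π (i + 1))

def IsStrat1 {S : Type} (isP1 : S → Prop) (E : S → S → Prop) (σ : List S → S → S) : Prop :=
  ∀ h s, isP1 s → E s (σ h s)

def Hist {S : Type} (π : ℕ → S) (n : ℕ) : List S := (List.range n).map π

def Consistent1 {S : Type} (isP1 : S → Prop) (σ : List S → S → S) (π : ℕ → S) : Prop :=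
  ∀ n, isP1 (π n) → π (n + 1) = σ (Hist π n) (π n)

def MooreStrat {S M : Type} (m0 : M) (αu : M → S → M) (αn : M → S → S) :
    List S → S → S :=
  fun h s => αn (h.foldl αu m0) s

noncomputable def MP {S : Type} (w : S → S → ℤ) (π : ℕ → S) : ℝ :=
  Filter.liminf (fun n => (EL1 w π n : ℝ) / n) Filter.atTop

def WinMPB {S : Type} (isP1 : S → Prop) (E : S → S → Prop)
    (w : S → S → ℤ) (F : Set S) : Set S :=
  {s | ∃ σ : List S → S → S, IsStrat1 isP1 E σ ∧
    ∀ π : ℕ → S, IsPlayFrom E s π → Consistent1 isP1 σ π →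
      0 ≤ MP w π ∧ ∀ N, ∃ n, N ≤ n ∧ π n ∈ F}

section Histories

variable {S : Type}

theorem length_hist (π : ℕ → S) (n : ℕ) : (Hist π n).length = n := by simp [Hist]

theorem hist_succ (π : ℕ → S) (n : ℕ) : Hist π (n + 1) = Hist π n ++ [π n] := by
  simp [Hist, List.range_succ]

theorem hist_congr {π ρ : ℕ → S} {n : ℕ} (h : ∀ i < n, π i = ρ i) : Hist π n = Hist ρ n :=
  List.map_congr_left fun i hi => h i (List.mem_range.1 hi)

theorem hist_add (π : ℕ → S) (k n : ℕ) :
    Hist π (k + n) = Hist π k ++ Hist (fun i => π (k + i)) n := by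
  simp [Hist, List.range_add, Function.comp_def]

theorem headD_hist (π : ℕ → S) (n : ℕ) : (Hist π n).headD (π n) = π 0 := by
  cases n <;> simp [Hist, List.range_succ_eq_map]

theorem getD_hist_succ (π : ℕ → S) {i n : ℕ} (h : i ≤ n) (d : S) :
    (Hist π n ++ [π n]).getD i d = π i := by
  rw [← hist_succ]
  simp [Hist, List.getD, Nat.lt_succ_of_le h]

theorem EL1_congr (w : S → S → ℤ) {π ρ : ℕ → S} {n : ℕ} (h : ∀ i ≤ n, π i = ρ i) :
    EL1 w π n = EL1 w ρ n :=
  Finset.sum_congr rfl fun i hi => by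
    have := Finset.mem_range.1 hi
    rw [h i (by omega), h (i + 1) (by omega)]

theorem EL1_add (w : S → S → ℤ) (π : ℕ → S) (k n : ℕ) :
    EL1 w π (k + n) = EL1 w π k + EL1 w (fun i => π (k + i)) n := by
  simp [EL1, Finset.sum_range_add, add_assoc]

end Histories

section MeanPayoff

variable {S : Type}

theorem exists_weight_bound [Finite S] (w : S → S → ℤ) :
    ∃ B : ℝ, 0 ≤ B ∧ ∀ (π : ℕ → S) (n : ℕ), |(EL1 w π n : ℝ)| ≤ B * n := by
  obtain ⟨B, hB⟩ := (Set.finite_range fun p : S × S => |(w p.1 p.2 : ℝ)|).bddAbove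
  refine ⟨max B 0, le_max_right _ _, fun π n => ?_⟩
  have hw (s t : S) : |(w s t : ℝ)| ≤ max B 0 := (hB ⟨(s, t), rfl⟩).trans (le_max_left _ _)
  calc |(EL1 w π n : ℝ)| ≤ ∑ i ∈ Finset.range n, |(w (π i) (π (i + 1)) : ℝ)| := by
        rw [EL1, Int.cast_sum]; exact Finset.abs_sum_le_sum_abs _ _
    _ ≤ ∑ _i ∈ Finset.range n, max B 0 := Finset.sum_le_sum fun i _ => hw _ _
    _ = max B 0 * n := by simp [mul_comm]

theorem le_MP_iff [Finite S] (w : S → S → ℤ) (π : ℕ → S) (c : ℝ) :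
    c ≤ MP w π ↔ ∀ δ > 0, ∀ᶠ n : ℕ in Filter.atTop, (c - δ) * n ≤ EL1 w π n := by
  obtain ⟨B, hB0, hB⟩ := exists_weight_bound w
  have habs (n : ℕ) : |(EL1 w π n : ℝ) / n| ≤ B := by
    rw [abs_div, Nat.abs_cast]
    exact div_le_of_le_mul₀ (Nat.cast_nonneg n) hB0 (hB π n)
  have hbdd : Filter.IsBoundedUnder (· ≥ ·) Filter.atTop fun n : ℕ => (EL1 w π n : ℝ) / n :=
    Filter.isBoundedUnder_of ⟨-B, fun n => (abs_le.1 (habs n)).1⟩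
  have hcobdd : Filter.IsCoboundedUnder (· ≥ ·) Filter.atTop fun n : ℕ => (EL1 w π n : ℝ) / n :=
    (Filter.isBoundedUnder_of ⟨B, fun n => (abs_le.1 (habs n)).2⟩ :
      Filter.IsBoundedUnder (· ≤ ·) Filter.atTop _).isCoboundedUnder_ge
  constructor
  · intro h δ hδ
    have hlt : c - δ < MP w π := by linarith
    filter_upwards [Filter.eventually_lt_of_lt_liminf hlt hbdd, Filter.eventually_gt_atTop 0]
      with n hn hpos
    exact (le_div_iff₀ (Nat.cast_pos.2 hpos)).1 hn.le
  · intro h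
    refine le_of_forall_pos_sub_le fun δ hδ => Filter.le_liminf_of_le hcobdd ?_
    filter_upwards [h δ hδ, Filter.eventually_gt_atTop 0] with n hn hpos
    exact (le_div_iff₀ (Nat.cast_pos.2 hpos)).2 hn

theorem MP_nonneg_shift [Finite S] (w : S → S → ℤ) (π : ℕ → S) (k : ℕ) (h : 0 ≤ MP w π) :
    0 ≤ MP w fun i => π (k + i) := by
  rw [le_MP_iff] at h ⊢
  intro δ hδ
  have hk : ∀ᶠ n : ℕ in Filter.atTop, (0 - δ / 2) * (k + n : ℕ) ≤ EL1 w π (k + n) :=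
    (Filter.tendsto_add_atTop_nat k).eventually (h (δ / 2) (half_pos hδ)) |>.mono
      fun n hn => by rwa [add_comm n k] at hn
  have hlarge : ∀ᶠ n : ℕ in Filter.atTop, δ / 2 * k + EL1 w π k ≤ δ / 2 * n :=
    (tendsto_natCast_atTop_atTop.const_mul_atTop (half_pos hδ)).eventually_ge_atTop _
  filter_upwards [hk, hlarge] with n hn hn'
  rw [EL1_add] at hn
  push_cast at hn
  linarith

theorem neg_le_MP_of_le_EL1 [Finite S] (w : S → S → ℤ) (π : ℕ → S) (ε C : ℝ)
    (h : ∀ n : ℕ, -ε * n - C ≤ EL1 w π n) : -ε ≤ MP w π := by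
  rw [le_MP_iff]
  intro δ hδ
  have hlarge : ∀ᶠ n : ℕ in Filter.atTop, C ≤ δ * n :=
    (tendsto_natCast_atTop_atTop.const_mul_atTop hδ).eventually_ge_atTop _
  filter_upwards [hlarge] with n hn
  linarith [h n]

end MeanPayoff

section Segments

variable {S : Type} (isP1 : S → Prop) (E : S → S → Prop) (w : S → S → ℤ) (F : Set S) (ε : ℝ)
  (σ : S → List S → S → S)

/-- The first `n` steps of `ρ` follow edges and the strategy assigned to the first state. -/
def IsSegment (ρ : ℕ → S) (n : ℕ) : Prop :=
  ∀ i < n, E (ρ i) (ρ (i + 1)) ∧ (isP1 (ρ i) → ρ (i + 1) = σ (ρ 0) (Hist ρ i) (ρ i))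

/-- A segment may be closed after `n` steps: it has visited `F` and its average weight is at
least `-ε`. -/
def IsClosable (ρ : ℕ → S) (n : ℕ) : Prop :=
  0 < n ∧ -ε * n ≤ EL1 w ρ n ∧ ∃ j < n, ρ j ∈ F

/-- `IsClosable` for a segment given by the list of its past states and its current state. -/
def IsClosableList (m : List S) (s : S) : Prop :=
  IsClosable w F ε (fun i => (m ++ [s]).getD i s) m.length

variable {isP1 E w F ε σ}

theorem IsSegment.congr {π ρ : ℕ → S} {n : ℕ} (h : ∀ i ≤ n, π i = ρ i)
    (hπ : IsSegment isP1 E σ π n) : IsSegment isP1 E σ ρ n := fun i hi => by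
  have := hπ i hi
  rwa [h 0 (by omega), h i (by omega), h (i + 1) (by omega),
    hist_congr fun j hj => h j (by omega)] at this

theorem IsClosable.congr {π ρ : ℕ → S} {n : ℕ} (h : ∀ i ≤ n, π i = ρ i)
    (hπ : IsClosable w F ε π n) : IsClosable w F ε ρ n := by
  obtain ⟨hn, hEL, j, hj, hF⟩ := hπ
  exact ⟨hn, by rwa [← EL1_congr w h], j, hj, by rwa [← h j hj.le]⟩

theorem isClosableList_hist (ρ : ℕ → S) (n : ℕ) :
    IsClosableList w F ε (Hist ρ n) (ρ n) ↔ IsClosable w F ε ρ n := by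
  rw [IsClosableList, length_hist]
  exact ⟨.congr fun i hi => getD_hist_succ ρ hi _, .congr fun i hi => (getD_hist_succ ρ hi _).symm⟩

/-- The current state of a segment played by a winning strategy is winning. -/
theorem IsSegment.mem_WinMPB [Finite S] {ρ : ℕ → S} {n : ℕ}
    (hσ : IsStrat1 isP1 E (σ (ρ 0)))
    (hwin : ∀ π : ℕ → S, IsPlayFrom E (ρ 0) π → Consistent1 isP1 (σ (ρ 0)) π →
      0 ≤ MP w π ∧ ∀ N, ∃ n, N ≤ n ∧ π n ∈ F)
    (hρ : IsSegment isP1 E σ ρ n) : ρ n ∈ WinMPB isP1 E w F := by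
  refine ⟨fun h s => σ (ρ 0) (Hist ρ n ++ h) s, fun h s hs => hσ _ s hs, fun π hπ hcons => ?_⟩
  let π' : ℕ → S := fun i => if i < n then ρ i else π (i - n)
  have hlow (i : ℕ) (hi : i ≤ n) : π' i = ρ i := by
    rcases hi.lt_or_eq with h | rfl
    · simp [π', h]
    · simp [π', hπ.1]
  have hhigh (i : ℕ) : π' (n + i) = π i := by simp [π']
  have hshift : (fun i => π' (n + i)) = π := funext hhigh
  have hseg : IsSegment isP1 E σ π' n := hρ.congr fun i hi => (hlow i hi).symm
  have h0 : π' 0 = ρ 0 := hlow 0 n.zero_le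
  have hplay : IsPlayFrom E (ρ 0) π' := by
    refine ⟨h0, fun i => ?_⟩
    rcases lt_or_ge i n with hi | hi
    · exact (hseg i hi).1
    · obtain ⟨j, rfl⟩ := Nat.exists_eq_add_of_le hi
      rw [hhigh, add_assoc, hhigh]
      exact hπ.2 j
  have hcons' : Consistent1 isP1 (σ (ρ 0)) π' := by
    intro i hP
    rcases lt_or_ge i n with hi | hi
    · rw [← h0]
      exact (hseg i hi).2 hP
    · obtain ⟨j, rfl⟩ := Nat.exists_eq_add_of_le hi
      rw [hhigh] at hP
      rw [hist_add, hshift, hhigh, add_assoc, hhigh, hist_congr fun i hi => hlow i hi.le]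
      exact hcons j hP
  obtain ⟨hMP, hF⟩ := hwin π' hplay hcons'
  refine ⟨hshift ▸ MP_nonneg_shift w π' n hMP, fun N => ?_⟩
  obtain ⟨i, hi, hiF⟩ := hF (n + N)
  obtain ⟨j, rfl⟩ := Nat.exists_eq_add_of_le (le_of_add_le_left hi)
  exact ⟨j, by omega, hhigh j ▸ hiF⟩

theorem isClosed_of_dependsOn_prefix [TopologicalSpace S] [DiscreteTopology S]
    {C : Set (ℕ → S)} (n : ℕ)
    (h : ∀ π ρ : ℕ → S, (∀ i ≤ n, π i = ρ i) → π ∈ C → ρ ∈ C) : IsClosed C := by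
  rw [← isOpen_compl_iff, isOpen_iff_mem_nhds]
  intro π hπ
  have hev : ∀ᶠ ρ in nhds π, ∀ i ∈ Finset.range (n + 1), ρ i = π i :=
    (Filter.eventually_all_finset _).2 fun i _ =>
      (continuous_apply i).continuousAt.eventually_mem
        ((isOpen_discrete {π i}).mem_nhds rfl)
  filter_upwards [hev] with ρ hρ hC
  exact hπ (h ρ π (fun i hi => hρ i (Finset.mem_range.2 (by omega))) hC)

/-- By compactness, segments played by winning strategies become closable within a uniformly
bounded number of steps. -/
theorem exists_segment_bound [Finite S] (hε : 0 < ε)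
    (hwin : ∀ t ∈ WinMPB isP1 E w F, ∀ π : ℕ → S, IsPlayFrom E t π → Consistent1 isP1 (σ t) π →
      0 ≤ MP w π ∧ ∀ N, ∃ n, N ≤ n ∧ π n ∈ F) :
    ∃ T, ∀ (ρ : ℕ → S) (n : ℕ), ρ 0 ∈ WinMPB isP1 E w F → IsSegment isP1 E σ ρ n →
      (∀ i ≤ n, ¬ IsClosable w F ε ρ i) → n < T := by
  by_contra! hcon
  let C (T : ℕ) : Set (ℕ → S) := {ρ | ρ 0 ∈ WinMPB isP1 E w F ∧ IsSegment isP1 E σ ρ T ∧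
    ∀ i ≤ T, ¬ IsClosable w F ε ρ i}
  have hmono (T T' : ℕ) (h : T ≤ T') : C T' ⊆ C T := fun ρ hρ =>
    ⟨hρ.1, fun i hi => hρ.2.1 i (hi.trans_le h), fun i hi => hρ.2.2 i (hi.trans h)⟩
  let : TopologicalSpace S := ⊥
  have : DiscreteTopology S := ⟨rfl⟩
  have hclosed (T : ℕ) : IsClosed (C T) := isClosed_of_dependsOn_prefix T fun π ρ h hπ =>
    ⟨h 0 T.zero_le ▸ hπ.1, hπ.2.1.congr h, fun i hi hc =>
      hπ.2.2 i hi (hc.congr fun j hj => (h j (hj.trans hi)).symm)⟩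
  obtain ⟨ρ, hρ⟩ := IsCompact.nonempty_iInter_of_sequence_nonempty_isCompact_isClosed C
    (fun T => hmono T (T + 1) T.le_succ)
    (fun T => by
      obtain ⟨ρ, n, h0, hseg, hcl, hn⟩ := hcon T
      exact ⟨ρ, hmono T n hn ⟨h0, hseg, hcl⟩⟩)
    (hclosed 0).isCompact hclosed
  have hρ (T : ℕ) : ρ ∈ C T := Set.mem_iInter.1 hρ T
  obtain ⟨hMP, hF⟩ := hwin (ρ 0) (hρ 0).1 ρ
    ⟨rfl, fun i => ((hρ (i + 1)).2.1 i i.lt_succ_self).1⟩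
    fun i => ((hρ (i + 1)).2.1 i i.lt_succ_self).2
  obtain ⟨j, -, hj⟩ := hF 0
  obtain ⟨n, hn, hjn⟩ := (((le_MP_iff w ρ 0).1 hMP ε hε).and (Filter.eventually_gt_atTop j)).exists
  rw [zero_sub] at hn
  exact (hρ n).2.2 n le_rfl ⟨by omega, hn, j, hjn, hj⟩

end Segments

section Restart

variable {S : Type} (w : S → S → ℤ) (F : Set S) (ε : ℝ) (σ : S → List S → S → S) (T : ℕ)

open Classical in
/-- Forget the past of the current segment as soon as the segment may be closed. -/
noncomputable def restart (m : List S) (s : S) : List S :=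
  if IsClosableList w F ε m s then [] else m

/-- The memory of the restarting strategy: the past states of the current segment. -/
abbrev SegmentMemory (S : Type) (T : ℕ) : Type := {m : List S // m.length ≤ T}

noncomputable def restartUpdate (m : SegmentMemory S T) (s : S) : SegmentMemory S T :=
  if h : (restart w F ε m.1 s ++ [s]).length ≤ T then ⟨_, h⟩ else ⟨[], T.zero_le⟩

noncomputable def restartNext (m : SegmentMemory S T) (s : S) : S :=
  σ ((restart w F ε m.1 s).headD s) (restart w F ε m.1 s) s

/-- The memory of the restarting strategy after the first `n` states of `π`. -/
noncomputable def restartMemory (π : ℕ → S) (n : ℕ) : SegmentMemory S T :=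
  (Hist π n).foldl (restartUpdate w F ε T) ⟨[], T.zero_le⟩

theorem restartMemory_succ (π : ℕ → S) (n : ℕ) :
    restartMemory w F ε T π (n + 1) =
      restartUpdate w F ε T (restartMemory w F ε T π n) (π n) := by
  simp [restartMemory, hist_succ]

variable (isP1 : S → Prop) (E : S → S → Prop)

/-- At time `k + l` the play `π` is `l` steps into a segment started at time `k`. -/
structure InSegment (π : ℕ → S) (k l : ℕ) : Prop where
  memory : restart w F ε (restartMemory w F ε T π (k + l)).1 (π (k + l)) =
    Hist (fun i => π (k + i)) l
  mem_win : π k ∈ WinMPB isP1 E w F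
  segment : IsSegment isP1 E σ (fun i => π (k + i)) l
  not_closable : ∀ i ≤ l, ¬ IsClosable w F ε (fun i => π (k + i)) i
  energy : -ε * k ≤ EL1 w π k

variable {w F ε σ T isP1 E} {π : ℕ → S} {k l : ℕ}

theorem InSegment.start (hmem : π k ∈ WinMPB isP1 E w F) (hen : -ε * k ≤ EL1 w π k)
    (hrestart : restart w F ε (restartMemory w F ε T π k).1 (π k) = []) :
    InSegment w F ε σ T isP1 E π k 0 where
  memory := by simpa [Hist] using hrestart
  mem_win := hmem
  segment := fun i hi => absurd hi i.not_lt_zero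
  not_closable := fun i hi hc => by have := hc.1; omega
  energy := hen

/-- One step either prolongs the current segment or closes it and starts a new one. -/
theorem InSegment.step [Finite S]
    (hσ : ∀ t, IsStrat1 isP1 E (σ t))
    (hwin : ∀ t ∈ WinMPB isP1 E w F, ∀ π : ℕ → S, IsPlayFrom E t π → Consistent1 isP1 (σ t) π →
      0 ≤ MP w π ∧ ∀ N, ∃ n, N ≤ n ∧ π n ∈ F)
    (hedge : ∀ i, E (π i) (π (i + 1)))
    (hcons : ∀ i, isP1 (π i) →
      π (i + 1) = restartNext w F ε σ T (restartMemory w F ε T π i) (π i))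
    (hl : l < T) (h : InSegment w F ε σ T isP1 E π k l) :
    InSegment w F ε σ T isP1 E π k (l + 1) ∨
      InSegment w F ε σ T isP1 E π (k + (l + 1)) 0 ∧ ∃ j, k ≤ j ∧ π j ∈ F := by
  set ρ : ℕ → S := fun i => π (k + i) with hρ
  have hmem : (restartMemory w F ε T π (k + (l + 1))).1 = Hist ρ (l + 1) := by
    rw [← add_assoc, restartMemory_succ, restartUpdate, h.memory]
    change (dite ((Hist ρ l ++ [ρ l]).length ≤ T) _ _ : SegmentMemory S T).1 = _
    rw [dif_pos (by simpa [length_hist] using hl), hist_succ]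
  have hseg : IsSegment isP1 E σ ρ (l + 1) := by
    intro i hi
    rcases (Nat.lt_succ_iff.1 hi).lt_or_eq with hi | rfl
    · exact h.segment i hi
    · refine ⟨hedge (k + i), fun hP => ?_⟩
      have := hcons (k + i) hP
      rw [restartNext, h.memory] at this
      rw [← headD_hist ρ i]
      exact this
  by_cases hc : IsClosable w F ε ρ (l + 1)
  · refine .inr ⟨.start ?_ ?_ ?_, ?_⟩
    · exact IsSegment.mem_WinMPB (ρ := ρ) (n := l + 1) (hσ _) (hwin _ h.mem_win) hseg
    · have := h.energy
      have := hc.2.1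
      rw [EL1_add]
      push_cast at this ⊢
      linarith
    · rw [hmem, restart, if_pos ((isClosableList_hist ρ _).2 hc)]
    · obtain ⟨-, -, j, -, hj⟩ := hc
      exact ⟨k + j, by omega, hj⟩
  · refine .inl ⟨?_, h.mem_win, hseg, fun i hi => ?_, h.energy⟩
    · rw [hmem, restart, if_neg (mt (isClosableList_hist ρ _).1 hc)]
    · rcases hi.lt_or_eq with hi | rfl
      · exact h.not_closable i (Nat.lt_succ_iff.1 hi)
      · exact hc

end Restart

/-- in mean-payoff Büchi games, `ε`-optimality can be achieved surely by
pure finite-memory strategies: from every winning state `s` and for every `ε > 0`,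
player 1 has a pure finite-memory strategy all of whose consistent plays visit `F`
infinitely often and have mean-payoff at least `−ε`. -/
theorem epsilon_optimal_finite_memory
    {S : Type} [Fintype S] (isP1 : S → Prop)
    (E : S → S → Prop) (hE : ∀ s, ∃ t, E s t)
    (w : S → S → ℤ) (F : Set S)
    (ε : ℝ) (hε : 0 < ε) (s : S) (hs : s ∈ WinMPB isP1 E w F) :
    ∃ (M : Type) (iM : Fintype M) (m0 : M) (αu : M → S → M) (αn : M → S → S),
      IsStrat1 isP1 E (MooreStrat m0 αu αn) ∧
      ∀ π : ℕ → S, IsPlayFrom E s π → Consistent1 isP1 (MooreStrat m0 αu αn) π →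
        (∀ N, ∃ n, N ≤ n ∧ π n ∈ F) ∧ -ε ≤ MP w π := by
  have hstrat (t : S) : ∃ σ : List S → S → S, IsStrat1 isP1 E σ ∧
      (t ∈ WinMPB isP1 E w F → ∀ π : ℕ → S, IsPlayFrom E t π → Consistent1 isP1 σ π →
        0 ≤ MP w π ∧ ∀ N, ∃ n, N ≤ n ∧ π n ∈ F) := by
    by_cases ht : t ∈ WinMPB isP1 E w F
    · obtain ⟨σ, hσ, hwin⟩ := ht
      exact ⟨σ, hσ, fun _ => hwin⟩
    · choose f hf using hE
      exact ⟨fun _ => f, fun _ s _ => hf s, fun h => absurd h ht⟩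
  choose σ hσ hwin using hstrat
  obtain ⟨T, hT⟩ := exists_segment_bound hε hwin
  have : Finite (SegmentMemory S T) := List.finite_length_le S T
  refine ⟨SegmentMemory S T, Fintype.ofFinite _, ⟨[], T.zero_le⟩, restartUpdate w F ε T,
    restartNext w F ε σ T, fun h t ht => hσ _ _ t ht, fun π hπ hcons => ?_⟩
  have hstep {k l : ℕ} (h : InSegment w F ε σ T isP1 E π k l) :=
    h.step hσ hwin hπ.2 hcons (hT _ l h.mem_win h.segment h.not_closable)
  have hinit : InSegment w F ε σ T isP1 E π 0 0 := by
    refine .start (hπ.1 ▸ hs) (by simp [EL1]) ?_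
    rw [restart]
    split_ifs <;> rfl
  have hnext (k : ℕ) (h : InSegment w F ε σ T isP1 E π k 0) :
      ∃ k' > k, InSegment w F ε σ T isP1 E π k' 0 ∧ ∃ j, k ≤ j ∧ π j ∈ F := by
    by_contra hcon
    have hall (l : ℕ) : InSegment w F ε σ T isP1 E π k l := by
      induction l with
      | zero => exact h
      | succ l ih => exact (hstep ih).resolve_right fun h' => hcon ⟨_, by omega, h'⟩
    have hTT := hall T
    exact lt_irrefl T (hT _ T hTT.mem_win hTT.segment hTT.not_closable)
  have hcofinal (N : ℕ) : ∃ k ≥ N, InSegment w F ε σ T isP1 E π k 0 := by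
    induction N with
    | zero => exact ⟨0, le_rfl, hinit⟩
    | succ N ih =>
      obtain ⟨k, hk, h⟩ := ih
      obtain ⟨k', hk', h', -⟩ := hnext k h
      exact ⟨k', by omega, h'⟩
  have hcover (n : ℕ) : ∃ k l, n = k + l ∧ InSegment w F ε σ T isP1 E π k l := by
    induction n with
    | zero => exact ⟨0, 0, rfl, hinit⟩
    | succ n ih =>
      obtain ⟨k, l, rfl, h⟩ := ih
      rcases hstep h with h' | ⟨h', -⟩
      · exact ⟨k, l + 1, rfl, h'⟩
      · exact ⟨k + (l + 1), 0, rfl, h'⟩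
  refine ⟨fun N => ?_, ?_⟩
  · obtain ⟨k, hk, h⟩ := hcofinal N
    obtain ⟨-, -, -, j, hj, hjF⟩ := hnext k h
    exact ⟨j, hk.trans hj, hjF⟩
  · obtain ⟨B, hB0, hB⟩ := exists_weight_bound w
    refine neg_le_MP_of_le_EL1 w π ε (B * T) fun n => ?_
    obtain ⟨k, l, rfl, h⟩ := hcover n
    have hlT : (l : ℝ) ≤ T :=
      Nat.cast_le.2 (hT _ l h.mem_win h.segment h.not_closable).le
    have hl := (abs_le.1 (hB (fun i => π (k + i)) l)).1
    have hBl : B * l ≤ B * T := mul_le_mul_of_nonneg_left hlT hB0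
    have hεl : 0 ≤ ε * l := by positivity
    have := h.energy
    rw [EL1_add]
    push_cast
    linarith

end Stmt17
end

section
/- Consider the one-player mean-payoff Büchi game with states s₀ and s₁ (both controlled by P₁), initial state s₀, edges (s₀,s₀) with weight 1, (s₀,s₁) with weight 1, (s₁,s₀) with weight 0, and Büchi set F = {s₁}. Then: (i) every ultimately periodic play (in particular, the outcome of any pure finite-memory strategy) that visits s₁ infinitely often has mean-payoff MP(π) < 1; (ii) there exists a play that visits s₁ infinitely often and has MP(π) = 1 (obtained by delaying the visits to s₁ for longer and longer intervals). Hence the optimal value 1 of the mean-payoff Büchi objective is attainable only with infinite memory. -/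
namespace Stmt19

def EL1 {S : Type} (w : S → S → ℤ) (π : ℕ → S) (n : ℕ) : ℤ :=
  ∑ i ∈ Finset.range n, w (π i) (π (i + 1))

/-- States: `false = s₀`, `true = s₁`. Edges: `s₀→s₀`, `s₀→s₁`, `s₁→s₀`
(no edge `s₁→s₁`). -/
def edge : Bool → Bool → Prop := fun a b => ¬ (a = true ∧ b = true)

/-- Weights: `w(s₀,s₀) = 1`, `w(s₀,s₁) = 1`, `w(s₁,s₀) = 0`. -/
def wt : Bool → Bool → ℤ := fun a _ => if a then 0 else 1

/-- Mean-payoff of a play (liminf of average energy levels). -/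
noncomputable def mp (π : ℕ → Bool) : ℝ :=
  Filter.liminf (fun n => (EL1 wt π n : ℝ) / n) Filter.atTop

theorem EL1_wt_le (π : ℕ → Bool) (n : ℕ) : EL1 wt π n ≤ n := by
  induction n with
  | zero => simp [EL1]
  | succ n ih =>
    simp only [EL1, Finset.sum_range_succ, wt] at *
    push_cast
    split_ifs <;> omega

theorem EL1_wt_nonneg (π : ℕ → Bool) (n : ℕ) : 0 ≤ EL1 wt π n :=
  Finset.sum_nonneg fun i _ => by simp only [wt]; split_ifs <;> simp

/-- Each step contributes at most `1`, and a step leaving `s₁` contributes nothing. -/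
theorem EL1_wt_add_le (π : ℕ → Bool) (n m : ℕ) (hm : 1 ≤ m) (hn : π n = true) :
    EL1 wt π (n + m) ≤ EL1 wt π n + m - 1 := by
  induction m, hm using Nat.le_induction with
  | base => simp [EL1, Finset.sum_range_succ, wt, hn]
  | succ m hm ih =>
    rw [← add_assoc]
    simp only [EL1, Finset.sum_range_succ, wt] at *
    push_cast
    split_ifs <;> omega

theorem average_nonneg (π : ℕ → Bool) (n : ℕ) : 0 ≤ (EL1 wt π n : ℝ) / n :=
  div_nonneg (by exact_mod_cast EL1_wt_nonneg π n) n.cast_nonneg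

theorem mp_lt_one_of_periodic (π : ℕ → Bool) (a m : ℕ) (hm : 1 ≤ m)
    (hper : ∀ n, a ≤ n → π (n + m) = π n) (hvisit : ∀ N, ∃ n, N ≤ n ∧ π n = true) :
    mp π < 1 := by
  obtain ⟨p, hap, hp⟩ := hvisit a
  have hvis : ∀ k, π (p + k * m) = true := by
    intro k
    induction k with
    | zero => simpa using hp
    | succ k ih =>
      rw [show p + (k + 1) * m = p + k * m + m by ring, hper _ (by nlinarith), ih]
  have hEL : ∀ k : ℕ, EL1 wt π (p + k * m) ≤ p + k * m - k := by
    intro k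
    induction k with
    | zero => simpa using EL1_wt_le π p
    | succ k ih =>
      have := EL1_wt_add_le π (p + k * m) m hm (hvis k)
      rw [show p + (k + 1) * m = p + k * m + m by ring]
      push_cast
      linarith
  have hpos : (0 : ℝ) < p + m := by positivity
  suffices h : mp π ≤ 1 - 1 / (p + m) by
    have : (0 : ℝ) < 1 / (p + m) := by positivity
    linarith
  refine Filter.liminf_le_of_frequently_le ?_
    (Filter.isBoundedUnder_of ⟨0, fun n => average_nonneg π n⟩)
  rw [Filter.frequently_atTop]
  intro N
  have hle : N + 1 ≤ (N + 1) * m := Nat.le_mul_of_pos_right _ hm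
  refine ⟨p + (N + 1) * m, by omega, ?_⟩
  have h : (EL1 wt π (p + (N + 1) * m) : ℝ) ≤ p + (N + 1) * m - (N + 1) := by
    exact_mod_cast hEL (N + 1)
  push_cast
  have hd : (0 : ℝ) < p + (N + 1) * m := by positivity
  rw [div_le_iff₀ hd]
  refine h.trans ?_
  have hkey : (p + (N + 1) * m : ℝ) / (p + m) ≤ N + 1 := by
    rw [div_le_iff₀ hpos]
    have : (0 : ℝ) ≤ N * p := by positivity
    linarith
  have : (1 - 1 / (p + m) : ℝ) * (p + (N + 1) * m)
      = p + (N + 1) * m - (p + (N + 1) * m) / (p + m) := by ring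
  linarith

/-- The play that visits `s₁` exactly at the times `2 ^ k - 1` with `1 ≤ k`. -/
def sparsePlay (n : ℕ) : Bool := decide (Nat.log 2 n < Nat.log 2 (n + 1))

theorem sparsePlay_edge (n : ℕ) : edge (sparsePlay n) (sparsePlay (n + 1)) := by
  simp only [edge, sparsePlay, decide_eq_true_eq]
  rintro ⟨h₁, h₂⟩
  rcases Nat.lt_or_ge n 2 with hn | hn
  · interval_cases n
    · exact absurd h₁ (by decide)
    · exact absurd h₂ (by decide)
  · have h : Nat.log 2 (n + 1 + 1) ≤ Nat.log 2 (n * 2) := Nat.log_mono_right (by omega)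
    rw [Nat.log_mul_base (by norm_num) (by omega)] at h
    omega

theorem sparsePlay_two_pow_sub_one (k : ℕ) : sparsePlay (2 ^ (k + 1) - 1) = true := by
  have h : 1 ≤ 2 ^ (k + 1) := Nat.one_le_two_pow
  have h2 : 2 ≤ 2 ^ (k + 1) := by rw [pow_succ]; have := Nat.one_le_two_pow (n := k); omega
  simp only [sparsePlay, decide_eq_true_eq, Nat.sub_add_cancel h]
  rw [Nat.log_pow (by norm_num)]
  exact Nat.log_lt_of_lt_pow (by omega) (by omega)

theorem sub_log_le_EL1_sparsePlay (n : ℕ) : (n : ℤ) - Nat.log 2 n ≤ EL1 wt sparsePlay n := by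
  induction n with
  | zero => simp [EL1]
  | succ n ih =>
    have hmono : Nat.log 2 n ≤ Nat.log 2 (n + 1) := Nat.log_mono_right n.le_succ
    simp only [EL1, Finset.sum_range_succ, wt] at *
    push_cast
    split_ifs with h
    · simp only [sparsePlay, decide_eq_true_eq] at h
      omega
    · omega

theorem tendsto_natLog_div_atTop :
    Filter.Tendsto (fun n : ℕ => (Nat.log 2 n : ℝ) / n) Filter.atTop (nhds 0) := by
  have h : Filter.Tendsto (fun n : ℕ => Real.log n / n / Real.log 2) Filter.atTop (nhds 0) := by
    have := (Real.isLittleO_log_id_atTop.tendsto_div_nhds_zero.comp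
      (tendsto_natCast_atTop_atTop (R := ℝ))).div_const (Real.log 2)
    simpa using this
  refine squeeze_zero (fun n => by positivity) (fun n => ?_) h
  rw [div_right_comm]
  gcongr
  simpa [Real.logb] using Real.natLog_le_logb n 2

theorem mp_sparsePlay : mp sparsePlay = 1 := by
  refine Filter.Tendsto.liminf_eq ?_
  have h : Filter.Tendsto (fun n : ℕ => 1 - (Nat.log 2 n : ℝ) / n) Filter.atTop (nhds 1) := by
    simpa using tendsto_natLog_div_atTop.const_sub 1
  refine tendsto_of_tendsto_of_tendsto_of_le_of_le' h tendsto_const_nhds ?_ ?_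
  all_goals
    filter_upwards [Filter.eventually_gt_atTop 0] with n hn
    have hn' : (0 : ℝ) < n := by exact_mod_cast hn
  · rw [one_sub_div hn'.ne']
    gcongr
    exact_mod_cast sub_log_le_EL1_sparsePlay n
  · rw [div_le_one hn']
    exact_mod_cast EL1_wt_le sparsePlay n

/-- in this one-player mean-payoff Büchi game (Büchi set `F = {s₁}`):
(i) every ultimately periodic play — in particular the outcome of any pure
finite-memory strategy — that visits `s₁` infinitely often has mean-payoff `< 1`;
(ii) some play visits `s₁` infinitely often and has mean-payoff `= 1`. Hence the
optimal value `1` is attainable only with infinite memory. -/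
theorem optimal_value_needs_infinite_memory :
    (∀ π : ℕ → Bool, π 0 = false → (∀ i, edge (π i) (π (i + 1))) →
      (∃ a m, 1 ≤ m ∧ ∀ n, a ≤ n → π (n + m) = π n) →
      (∀ N, ∃ n, N ≤ n ∧ π n = true) →
      mp π < 1) ∧
    (∃ π : ℕ → Bool, π 0 = false ∧ (∀ i, edge (π i) (π (i + 1))) ∧
      (∀ N, ∃ n, N ≤ n ∧ π n = true) ∧ mp π = 1) := by
  refine ⟨fun π _ _ ⟨a, m, hm, hper⟩ hvisit => mp_lt_one_of_periodic π a m hm hper hvisit,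
    sparsePlay, by simp [sparsePlay], sparsePlay_edge, fun N => ?_, mp_sparsePlay⟩
  refine ⟨2 ^ (N + 1) - 1, ?_, sparsePlay_two_pow_sub_one N⟩
  have : N + 1 < 2 ^ (N + 1) := Nat.lt_two_pow_self
  omega

end Stmt19
end
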